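/- arXiv:1406.6307 — 15 statements merged into one kernel-verified Lean document; each statement's English description precedes it below -/
import Mathlib

section
/- For every integer n > 2, the fraction 4/n is 3-Egyptian if and only if there exist positive integers x < y < z with (4 : ℚ)/n = 1/x + 1/y + 1/z (i.e. 4/n is a sum of exactly three pairwise distinct unit fractions). -/
/-- `4/n` is 3-Egyptian: a sum of (at most) three unit fractions with positive
integer denominators (not necessarily distinct). -/
def IsEgyptian3 (n : ℕ) : Prop :=
  ∃ x y z : ℕ, 0 < x ∧ 0 < y ∧ 0 < z ∧ (4 : ℚ) / n = 1 / x + 1 / y + 1 / z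

/-- Pairwise distinct denominators can be put in increasing order. -/
theorem exists_ordered_of_ne {q : ℚ} {x y z : ℕ} (hx : 0 < x) (hy : 0 < y) (hz : 0 < z)
    (hxy : x ≠ y) (hxz : x ≠ z) (hyz : y ≠ z) (h : q = 1 / x + 1 / y + 1 / z) :
    ∃ x y z : ℕ, 0 < x ∧ x < y ∧ y < z ∧ q = 1 / x + 1 / y + 1 / z := by
  rcases hxy.lt_or_gt with h1 | h1 <;> rcases hxz.lt_or_gt with h2 | h2 <;>
    rcases hyz.lt_or_gt with h3 | h3
  · exact ⟨x, y, z, hx, h1, h3, h⟩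
  · exact ⟨x, z, y, hx, h2, h3, by rw [h]; ring⟩
  · omega
  · exact ⟨z, x, y, hz, h2, h1, by rw [h]; ring⟩
  · exact ⟨y, x, z, hy, h1, h2, by rw [h]; ring⟩
  · omega
  · exact ⟨y, z, x, hy, h3, h2, by rw [h]; ring⟩
  · exact ⟨z, y, x, hz, h3, h1, by rw [h]; ring⟩

theorem one_div_eq_split {m : ℕ} (hm : 0 < m) :
    (1 : ℚ) / m = 1 / (m + 1 : ℕ) + 1 / (m * (m + 1) : ℕ) := by
  have : (m : ℚ) ≠ 0 := by positivity
  have : (m : ℚ) + 1 ≠ 0 := by positivity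
  push_cast
  field_simp

/-- Twice a unit fraction with odd denominator `2 * m + 1` as a sum of two unit fractions. -/
theorem two_div_odd_eq {m : ℕ} :
    (1 : ℚ) / (2 * m + 1 : ℕ) + 1 / (2 * m + 1 : ℕ) =
      1 / (m + 1 : ℕ) + 1 / ((m + 1) * (2 * m + 1) : ℕ) := by
  have : (m : ℚ) + 1 ≠ 0 := by positivity
  have : 2 * (m : ℚ) + 1 ≠ 0 := by positivity
  push_cast
  field_simp
  ring

theorem exists_distinct_of_lt {q : ℚ} {a b : ℕ} (ha : 0 < a) (hab : a < b)
    (h : q = 1 / a + 1 / b) :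
    ∃ x y z : ℕ, 0 < x ∧ x < y ∧ y < z ∧ q = 1 / x + 1 / y + 1 / z :=
  ⟨a, b + 1, b * (b + 1), ha, by omega, by nlinarith, by
    rw [h, one_div_eq_split (by omega : 0 < b), add_assoc]⟩

/-- A sum of two unit fractions other than `2` is a sum of three distinct ones. -/
theorem exists_distinct_of_two {q : ℚ} {a b : ℕ} (ha : 0 < a) (hb : 0 < b) (hq : q < 2)
    (h : q = 1 / a + 1 / b) :
    ∃ x y z : ℕ, 0 < x ∧ x < y ∧ y < z ∧ q = 1 / x + 1 / y + 1 / z := by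
  rcases lt_trichotomy a b with hab | rfl | hab
  · exact exists_distinct_of_lt ha hab h
  · obtain ⟨c, rfl | rfl⟩ := a.even_or_odd'
    · have hc : 0 < c := by omega
      refine ⟨2 * c, 3 * c, 6 * c, by omega, by omega, by omega, ?_⟩
      have : (c : ℚ) ≠ 0 := by positivity
      rw [h]
      push_cast
      field_simp
      norm_num
    · have hc : 0 < c := by
        rcases Nat.eq_zero_or_pos c with rfl | hc
        · norm_num at h
          linarith
        · exact hc
      exact exists_distinct_of_lt (by omega) (by nlinarith) (h.trans two_div_odd_eq)
  · exact exists_distinct_of_lt hb hab (by rw [h, add_comm])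

theorem exists_distinct_of_double {n x z : ℕ} (hn : 2 < n) (hx : 0 < x) (hz : 0 < z)
    (h : (4 : ℚ) / n = 1 / x + 1 / x + 1 / z) :
    ∃ x y z : ℕ, 0 < x ∧ x < y ∧ y < z ∧ (4 : ℚ) / n = 1 / x + 1 / y + 1 / z := by
  have hn0 : (n : ℚ) ≠ 0 := by positivity
  have hlt : (4 : ℚ) / n < 2 := by
    rw [div_lt_iff₀ (by positivity)]
    have : (2 : ℚ) < n := by exact_mod_cast hn
    linarith
  obtain ⟨m, rfl | rfl⟩ := x.even_or_odd'
  · have hm : 0 < m := by omega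
    have hm0 : (m : ℚ) ≠ 0 := by positivity
    refine exists_distinct_of_two hm hz hlt ?_
    rw [h]
    push_cast
    field_simp
    ring
  · have hz0 : (0 : ℚ) < (z : ℚ)⁻¹ := by positivity
    have hm : 0 < m := by
      rcases Nat.eq_zero_or_pos m with rfl | hm
      · norm_num at h
        linarith
      · exact hm
    have hm1 : (m : ℚ) + 1 ≠ 0 := by positivity
    have hm2 : 2 * (m : ℚ) + 1 ≠ 0 := by positivity
    rw [two_div_odd_eq] at h
    refine exists_ordered_of_ne (by omega) (by positivity) hz (by nlinarith) ?_ ?_ h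
    · rintro rfl
      push_cast at h
      field_simp at h
      have key : (n : ℤ) * (4 * m + 3) = 4 * (m + 1) * (2 * m + 1) := by
        have : (n : ℚ) * (4 * m + 3) = 4 * (m + 1) * (2 * m + 1) := by linarith
        exact_mod_cast this
      have hdvd : (4 * m + 3 : ℤ) ∣ 1 :=
        ⟨4 * m + 3 - 2 * n, by linarith⟩
      have := Int.le_of_dvd one_pos hdvd
      omega
    · rintro rfl
      push_cast at h
      field_simp at h
      have key : (n : ℤ) * (2 * m + 3) = 4 * (m + 1) * (2 * m + 1) := by
        have : (n : ℚ) * (2 * m + 3) = 4 * (m + 1) * (2 * m + 1) := by linarith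
        exact_mod_cast this
      have hdvd : (2 * m + 3 : ℤ) ∣ 4 := ⟨n - 4 * m, by linarith⟩
      have := Int.le_of_dvd (by norm_num) hdvd
      omega

theorem stmt_0 (n : ℕ) (hn : 2 < n) :
    IsEgyptian3 n ↔
      ∃ x y z : ℕ, 0 < x ∧ x < y ∧ y < z ∧
        (4 : ℚ) / n = 1 / x + 1 / y + 1 / z := by
  constructor
  · rintro ⟨x, y, z, hx, hy, hz, h⟩
    by_cases hxy : x = y
    · subst hxy
      exact exists_distinct_of_double hn hx hz h
    by_cases hxz : x = z
    · subst hxz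
      exact exists_distinct_of_double hn hx hy (by rw [h]; ring)
    by_cases hyz : y = z
    · subst hyz
      exact exists_distinct_of_double hn hy hx (by rw [h]; ring)
    exact exists_ordered_of_ne hx hy hz hxy hxz hyz h
  · rintro ⟨x, y, z, hx, hxy, hyz, h⟩
    exact ⟨x, y, z, hx, by omega, by omega, h⟩
end

section
/- If 4/p is 3-Egyptian for every prime number p with p ≡ 1 (mod 24), then 4/n is 3-Egyptian for every integer n ≥ 2 (i.e. the Erdős–Straus conjecture holds). -/
lemma IsEgyptian3.mul_right {n : ℕ} (hn : IsEgyptian3 n) {k : ℕ} (hk : 0 < k) :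
    IsEgyptian3 (n * k) := by
  obtain ⟨x, y, z, hx, hy, hz, h⟩ := hn
  refine ⟨x * k, y * k, z * k, by positivity, by positivity, by positivity, ?_⟩
  push_cast
  simp only [← div_div, ← add_div, h]

lemma isEgyptian3_two : IsEgyptian3 2 :=
  ⟨1, 2, 2, by norm_num, by norm_num, by norm_num, by norm_num⟩

lemma isEgyptian3_four_mul_add_three (k : ℕ) : IsEgyptian3 (4 * k + 3) := by
  refine ⟨k + 1, 2 * ((4 * k + 3) * (k + 1)), 2 * ((4 * k + 3) * (k + 1)),
    by positivity, by positivity, by positivity, ?_⟩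
  push_cast
  field_simp
  ring

lemma isEgyptian3_three_mul_add_two (k : ℕ) : IsEgyptian3 (3 * k + 2) := by
  refine ⟨3 * k + 2, k + 1, (3 * k + 2) * (k + 1),
    by positivity, by positivity, by positivity, ?_⟩
  push_cast
  field_simp
  ring

lemma isEgyptian3_eight_mul_add_five (k : ℕ) : IsEgyptian3 (8 * k + 5) := by
  refine ⟨2 * (k + 1), (8 * k + 5) * (k + 1), (8 * k + 5) * (2 * (k + 1)),
    by positivity, by positivity, by positivity, ?_⟩
  push_cast
  field_simp
  ring

lemma Nat.Prime.isEgyptian3_of_mod_ne_one {p : ℕ} (hp : p.Prime) (hmod : p % 24 ≠ 1) :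
    IsEgyptian3 p := by
  rcases hp.eq_two_or_odd with rfl | hodd
  · exact isEgyptian3_two
  by_cases h4 : p % 4 = 3
  · obtain ⟨k, rfl⟩ : ∃ k, p = 4 * k + 3 := ⟨p / 4, by omega⟩
    exact isEgyptian3_four_mul_add_three k
  by_cases h3 : p % 3 = 2
  · obtain ⟨k, rfl⟩ : ∃ k, p = 3 * k + 2 := ⟨p / 3, by omega⟩
    exact isEgyptian3_three_mul_add_two k
  by_cases h8 : p % 8 = 5
  · obtain ⟨k, rfl⟩ : ∃ k, p = 8 * k + 5 := ⟨p / 8, by omega⟩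
    exact isEgyptian3_eight_mul_add_five k
  have hdvd : 3 ∣ p := by omega
  have hp3 : 3 = p := (Nat.prime_dvd_prime_iff_eq Nat.prime_three hp).mp hdvd
  omega

theorem stmt_5
    (h : ∀ p : ℕ, p.Prime → p % 24 = 1 → IsEgyptian3 p) :
    ∀ n : ℕ, 2 ≤ n → IsEgyptian3 n := by
  intro n hn
  obtain ⟨p, hp, k, rfl⟩ := Nat.exists_prime_and_dvd (show n ≠ 1 by omega)
  have hk : 0 < k := Nat.pos_of_ne_zero (by rintro rfl; omega)
  refine IsEgyptian3.mul_right ?_ hk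
  by_cases hmod : p % 24 = 1
  · exact h p hp hmod
  · exact hp.isEgyptian3_of_mod_ne_one hmod
end

section
/- (Rosati) Let p be an odd prime number. The fraction 4/p is 3-Egyptian if and only if there exist positive integers A, B, C, D such that either (4ABCD = A + B + pC and gcd(ABD, p) = 1) or (4ABCD = p(A + B) + C and gcd(ABCD, p) = 1). -/
theorem Nat.eq_gcd_mul_gcd_of_dvd_mul {x y z : ℕ} (h : x ∣ y * z)
    (hc : Nat.gcd x (Nat.gcd y z) = 1) : x = Nat.gcd x y * Nat.gcd x z := by
  apply Nat.dvd_antisymm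
  · have := Nat.gcd_mul_right_dvd_mul_gcd x y z
    rwa [Nat.gcd_eq_left h] at this
  · apply Nat.Coprime.mul_dvd_of_dvd_of_dvd _ (Nat.gcd_dvd_left x y) (Nat.gcd_dvd_left x z)
    apply Nat.eq_one_of_dvd_one
    rw [← hc]
    have h1 := Nat.gcd_dvd_left (x.gcd y) (x.gcd z)
    have h2 := Nat.gcd_dvd_right (x.gcd y) (x.gcd z)
    exact Nat.dvd_gcd (h1.trans (Nat.gcd_dvd_left x y))
      (Nat.dvd_gcd (h1.trans (Nat.gcd_dvd_right x y)) (h2.trans (Nat.gcd_dvd_right x z)))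

/-- If each of `x`, `y`, `z` divides the product of the other two and they have no common factor,
then they are the pairwise products of three numbers. -/
theorem Nat.exists_pairwise_mul_of_dvd_mul {x y z : ℕ} (hx : x ∣ y * z) (hy : y ∣ x * z)
    (hz : z ∣ x * y) (hc : Nat.gcd x (Nat.gcd y z) = 1) :
    ∃ A B C : ℕ, x = B * C ∧ y = A * C ∧ z = A * B := by
  refine ⟨Nat.gcd y z, Nat.gcd x z, Nat.gcd x y, ?_, ?_, ?_⟩
  · rw [mul_comm]
    exact Nat.eq_gcd_mul_gcd_of_dvd_mul hx hc
  · rw [mul_comm, Nat.gcd_comm x y]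
    exact Nat.eq_gcd_mul_gcd_of_dvd_mul hy (by rwa [Nat.gcd_left_comm])
  · rw [mul_comm, Nat.gcd_comm x z, Nat.gcd_comm y z]
    exact Nat.eq_gcd_mul_gcd_of_dvd_mul hz (by rwa [Nat.gcd_comm, Nat.gcd_assoc])

/-- Parametrization of the solutions of `4 = m / x + n / y + k / z` in lowest terms. -/
theorem exists_parametrization {x y z m n k : ℕ} (hx : 0 < x) (hy : 0 < y) (hz : 0 < z)
    (hm : Nat.Coprime x m) (hn : Nat.Coprime y n) (hk : Nat.Coprime z k)
    (h : 4 * x * y * z = m * (y * z) + n * (x * z) + k * (x * y)) :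
    ∃ A B C D : ℕ, 0 < A ∧ 0 < B ∧ 0 < C ∧ 0 < D ∧
      x = B * C * D ∧ y = A * C * D ∧ z = A * B * D ∧
      4 * A * B * C * D = m * A + n * B + k * C := by
  obtain ⟨D, x, y, z, hD, hc, rfl, rfl, rfl⟩ : ∃ D u v w : ℕ, 0 < D ∧
      Nat.gcd u (Nat.gcd v w) = 1 ∧ x = u * D ∧ y = v * D ∧ z = w * D := by
    have hD : 0 < Nat.gcd x (Nat.gcd y z) := Nat.gcd_pos_of_pos_left _ hx
    obtain ⟨u, hu⟩ := Nat.gcd_dvd_left x (Nat.gcd y z)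
    obtain ⟨v, hv⟩ := (Nat.gcd_dvd_right x (Nat.gcd y z)).trans (Nat.gcd_dvd_left y z)
    obtain ⟨w, hw⟩ := (Nat.gcd_dvd_right x (Nat.gcd y z)).trans (Nat.gcd_dvd_right y z)
    generalize hg : Nat.gcd x (Nat.gcd y z) = D at *
    refine ⟨D, u, v, w, hD, ?_, by rw [hu, mul_comm], by rw [hv, mul_comm], by rw [hw, mul_comm]⟩
    rw [hu, hv, hw, Nat.gcd_mul_left, Nat.gcd_mul_left] at hg
    exact Nat.eq_of_mul_eq_mul_left hD (by rw [hg, mul_one])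
  have h' : 4 * D * x * y * z = m * (y * z) + n * (x * z) + k * (x * y) := by
    have : 0 < D * D := by positivity
    apply Nat.eq_of_mul_eq_mul_left this
    linear_combination h
  have dx : x ∣ y * z := by
    apply hm.coprime_mul_right.dvd_of_dvd_mul_left
    have h1 : x ∣ m * (y * z) + x * (n * z + k * y) := ⟨4 * D * y * z, by linear_combination -h'⟩
    exact (Nat.dvd_add_left (dvd_mul_right _ _)).1 h1
  have dy : y ∣ x * z := by
    apply hn.coprime_mul_right.dvd_of_dvd_mul_left
    have h1 : y ∣ n * (x * z) + y * (m * z + k * x) := ⟨4 * D * x * z, by linear_combination -h'⟩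
    exact (Nat.dvd_add_left (dvd_mul_right _ _)).1 h1
  have dz : z ∣ x * y := by
    apply hk.coprime_mul_right.dvd_of_dvd_mul_left
    have h1 : z ∣ k * (x * y) + z * (m * y + n * x) := ⟨4 * D * x * y, by linear_combination -h'⟩
    exact (Nat.dvd_add_left (dvd_mul_right _ _)).1 h1
  obtain ⟨A, B, C, rfl, rfl, rfl⟩ := Nat.exists_pairwise_mul_of_dvd_mul dx dy dz hc
  have hA : 0 < A := by by_contra!; simp_all
  have hB : 0 < B := by by_contra!; simp_all
  have hC : 0 < C := by by_contra!; simp_all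
  refine ⟨A, B, C, D, hA, hB, hC, hD, rfl, rfl, rfl, ?_⟩
  have : 0 < A * B * C := by positivity
  apply Nat.eq_of_mul_eq_mul_left this
  linear_combination h'

/-- The existence of a parametrized representation of `4 / p`. -/
def HasRosatiForm (p : ℕ) : Prop :=
  ∃ A B C D : ℕ, 0 < A ∧ 0 < B ∧ 0 < C ∧ 0 < D ∧
    ((4 * A * B * C * D = A + B + p * C ∧ Nat.gcd (A * B * D) p = 1) ∨
     (4 * A * B * C * D = p * (A + B) + C ∧ Nat.gcd (A * B * C * D) p = 1))

/-- The case where the denominators `p * x` and `p * y` are multiples of `p` and `z` is not. -/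
theorem hasRosatiForm_of_two_multiples {p x y z : ℕ} (hp : p.Prime)
    (hx : 0 < x) (hy : 0 < y) (hz : 0 < z) (hpz : ¬ p ∣ z)
    (h : 4 * x * y * z = z * (x + y) + p * (x * y)) : HasRosatiForm p := by
  have hcz : Nat.Coprime z p := ((Nat.Prime.coprime_iff_not_dvd hp).2 hpz).symm
  obtain ⟨A, B, C, D, hA, hB, hC, hD, -, -, rfl, h'⟩ :=
    exists_parametrization (m := 1) (n := 1) (k := p) hx hy hz (by simp) (by simp) hcz
      (by linear_combination h)
  exact ⟨A, B, C, D, hA, hB, hC, hD, .inl ⟨by linear_combination h', hcz⟩⟩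

/-- The case where exactly the denominator `p * z` is a multiple of `p`. -/
theorem hasRosatiForm_of_one_multiple {p x y z : ℕ} (hp : p.Prime)
    (hx : 0 < x) (hy : 0 < y) (hz : 0 < z) (hpx : ¬ p ∣ x) (hpy : ¬ p ∣ y)
    (h : 4 * x * y * z = p * (z * (x + y)) + x * y) : HasRosatiForm p := by
  have hpz : ¬ p ∣ z := by
    intro hd
    have h1 : p ∣ p * (z * (x + y)) + x * y := by
      rw [← h]
      exact hd.mul_left _
    have h2 := (Nat.dvd_add_right (dvd_mul_right _ _)).1 h1
    exact (hp.dvd_mul.1 h2).elim hpx hpy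
  have hc {t : ℕ} (ht : ¬ p ∣ t) : Nat.Coprime t p :=
    ((Nat.Prime.coprime_iff_not_dvd hp).2 ht).symm
  obtain ⟨A, B, C, D, hA, hB, hC, hD, rfl, rfl, rfl, h'⟩ :=
    exists_parametrization (m := p) (n := p) (k := 1) hx hy hz (hc hpx) (hc hpy) (by simp)
      (by linear_combination h)
  refine ⟨A, B, C, D, hA, hB, hC, hD, .inr ⟨by linear_combination h', hc ?_⟩⟩
  simp only [hp.dvd_mul] at *
  tauto

theorem hasRosatiForm_of_eq {p x y z : ℕ} (hp : p.Prime) (hodd : Odd p)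
    (hx : 0 < x) (hy : 0 < y) (hz : 0 < z)
    (h : 4 * x * y * z = p * (y * z + x * z + x * y)) : HasRosatiForm p := by
  have hp0 := hp.pos
  have h4 : ¬ p ∣ 4 := by
    intro h
    have h2 : p ∣ 2 := hp.dvd_of_dvd_pow (n := 2) h
    rw [(Nat.prime_dvd_prime_iff_eq hp Nat.prime_two).1 h2] at hodd
    exact absurd hodd (by decide)
  have hd : p ∣ x ∨ p ∣ y ∨ p ∣ z := by
    have : p ∣ 4 * x * y * z := h ▸ dvd_mul_right _ _
    simp only [hp.dvd_mul] at this
    tauto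
  by_cases dx : p ∣ x <;> by_cases dy : p ∣ y <;> by_cases dz : p ∣ z
  · obtain ⟨x, rfl⟩ := dx
    obtain ⟨y, rfl⟩ := dy
    obtain ⟨z, rfl⟩ := dz
    have h' : 4 * x * y * z = y * z + x * z + x * y := by
      apply Nat.eq_of_mul_eq_mul_left (show 0 < p * p * p by positivity)
      linear_combination h
    have hx := Nat.pos_of_mul_pos_left hx
    have hy := Nat.pos_of_mul_pos_left hy
    have hz := Nat.pos_of_mul_pos_left hz
    have h1 : 1 * (y * z) ≤ x * (y * z) := Nat.mul_le_mul_right _ hx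
    have h2 : 1 * (x * z) ≤ y * (x * z) := Nat.mul_le_mul_right _ hy
    have h3 : 1 * (x * y) ≤ z * (x * y) := Nat.mul_le_mul_right _ hz
    have : 0 < x * y * z := by positivity
    nlinarith
  · obtain ⟨x, rfl⟩ := dx
    obtain ⟨y, rfl⟩ := dy
    refine hasRosatiForm_of_two_multiples hp (Nat.pos_of_mul_pos_left hx)
      (Nat.pos_of_mul_pos_left hy) hz dz ?_
    apply Nat.eq_of_mul_eq_mul_left (show 0 < p * p by positivity)
    linear_combination h
  · obtain ⟨x, rfl⟩ := dx
    obtain ⟨z, rfl⟩ := dz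
    refine hasRosatiForm_of_two_multiples hp (Nat.pos_of_mul_pos_left hx)
      (Nat.pos_of_mul_pos_left hz) hy dy ?_
    apply Nat.eq_of_mul_eq_mul_left (show 0 < p * p by positivity)
    linear_combination h
  · obtain ⟨x, rfl⟩ := dx
    refine hasRosatiForm_of_one_multiple hp hy hz (Nat.pos_of_mul_pos_left hx) dy dz ?_
    apply Nat.eq_of_mul_eq_mul_left hp0
    linear_combination h
  · obtain ⟨y, rfl⟩ := dy
    obtain ⟨z, rfl⟩ := dz
    refine hasRosatiForm_of_two_multiples hp (Nat.pos_of_mul_pos_left hy)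
      (Nat.pos_of_mul_pos_left hz) hx dx ?_
    apply Nat.eq_of_mul_eq_mul_left (show 0 < p * p by positivity)
    linear_combination h
  · obtain ⟨y, rfl⟩ := dy
    refine hasRosatiForm_of_one_multiple hp hx hz (Nat.pos_of_mul_pos_left hy) dx dz ?_
    apply Nat.eq_of_mul_eq_mul_left hp0
    linear_combination h
  · obtain ⟨z, rfl⟩ := dz
    refine hasRosatiForm_of_one_multiple hp hx hy (Nat.pos_of_mul_pos_left hz) dx dy ?_
    apply Nat.eq_of_mul_eq_mul_left hp0
    linear_combination h
  · tauto

theorem isEgyptian3_of_eq {n x y z : ℕ} (hn : 0 < n) (hx : 0 < x) (hy : 0 < y) (hz : 0 < z)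
    (h : 4 * x * y * z = n * (y * z + x * z + x * y)) : IsEgyptian3 n := by
  refine ⟨x, y, z, hx, hy, hz, ?_⟩
  have h' : (4 * x * y * z : ℚ) = n * (y * z + x * z + x * y) := by exact_mod_cast h
  field_simp
  linear_combination h'

theorem stmt_6 (p : ℕ) (hp : p.Prime) (hodd : Odd p) :
    IsEgyptian3 p ↔
      ∃ A B C D : ℕ, 0 < A ∧ 0 < B ∧ 0 < C ∧ 0 < D ∧
        ((4 * A * B * C * D = A + B + p * C ∧ Nat.gcd (A * B * D) p = 1) ∨
         (4 * A * B * C * D = p * (A + B) + C ∧ Nat.gcd (A * B * C * D) p = 1)) := by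
  have hp0 := hp.pos
  constructor
  · rintro ⟨x, y, z, hx, hy, hz, h⟩
    refine hasRosatiForm_of_eq hp hodd hx hy hz ?_
    field_simp at h
    have h' : (4 * x * y * z : ℚ) = p * (y * z + x * z + x * y) := by linear_combination h
    exact_mod_cast h'
  · rintro ⟨A, B, C, D, hA, hB, hC, hD, ⟨h, -⟩ | ⟨h, -⟩⟩
    · refine isEgyptian3_of_eq (x := B * C * D * p) (y := A * C * D * p) (z := A * B * D) hp0
        (by positivity) (by positivity) (by positivity) ?_
      linear_combination A * B * C * D * D * p * p * h
    · refine isEgyptian3_of_eq (x := B * C * D) (y := A * C * D) (z := A * B * D * p) hp0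
        (by positivity) (by positivity) (by positivity) ?_
      linear_combination A * B * C * D * D * p * h
end

section
/- Let n be a positive integer. If there exist positive integers A, B, C, D with 4ABCD = A + B + nC, then 4/n = 1/(nBCD) + 1/(nACD) + 1/(ABD), and if there exist positive integers A, B, C, D with 4ABCD = n(A + B) + C, then 4/n = 1/(BCD) + 1/(ACD) + 1/(nABD); in either case 4/n is 3-Egyptian. -/
theorem stmt_7 (n : ℕ) (hn : 0 < n) :
    (∀ A B C D : ℕ, 0 < A → 0 < B → 0 < C → 0 < D →
      4 * A * B * C * D = A + B + n * C →
        (4 : ℚ) / n =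
            1 / ((n : ℚ) * B * C * D) + 1 / ((n : ℚ) * A * C * D)
              + 1 / ((A : ℚ) * B * D)
          ∧ IsEgyptian3 n) ∧
    (∀ A B C D : ℕ, 0 < A → 0 < B → 0 < C → 0 < D →
      4 * A * B * C * D = n * (A + B) + C →
        (4 : ℚ) / n =
            1 / ((B : ℚ) * C * D) + 1 / ((A : ℚ) * C * D)
              + 1 / ((n : ℚ) * A * B * D)
          ∧ IsEgyptian3 n) := by
  constructor
  · intro A B C D hA hB hC hD h
    have hsum : (4 : ℚ) / n =
        1 / ((n : ℚ) * B * C * D) + 1 / ((n : ℚ) * A * C * D) + 1 / ((A : ℚ) * B * D) := by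
      have hq : (4 : ℚ) * A * B * C * D = A + B + n * C := by exact_mod_cast h
      field_simp
      linear_combination hq
    refine ⟨hsum, n * B * C * D, n * A * C * D, A * B * D,
      by positivity, by positivity, by positivity, ?_⟩
    push_cast
    exact hsum
  · intro A B C D hA hB hC hD h
    have hsum : (4 : ℚ) / n =
        1 / ((B : ℚ) * C * D) + 1 / ((A : ℚ) * C * D) + 1 / ((n : ℚ) * A * B * D) := by
      have hq : (4 : ℚ) * A * B * C * D = n * (A + B) + C := by exact_mod_cast h
      field_simp
      linear_combination hq
    refine ⟨hsum, B * C * D, A * C * D, n * A * B * D,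
      by positivity, by positivity, by positivity, ?_⟩
    push_cast
    exact hsum
end

section
/- (Schinzel's theorem) Let a be a positive integer and b an integer with gcd(a, b) = 1, and let p = a·X + b ∈ ℤ[X]. If 4/p is 3-Egyptian over ℤ[X], then b is a quadratic non-residue modulo a, i.e. there is no integer c with c² ≡ b (mod a). -/
open Polynomial

/-- `4/p` is 3-Egyptian over `ℤ[X]`: there are three polynomials with positive
leading coefficient such that `4/p = 1/X₁ + 1/X₂ + 1/X₃`, i.e.
`4·X₁·X₂·X₃ = p·(X₂·X₃ + X₃·X₁ + X₁·X₂)`. -/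
def IsEgyptian3Poly (p : Polynomial ℤ) : Prop :=
  ∃ X₁ X₂ X₃ : Polynomial ℤ,
    0 < X₁.leadingCoeff ∧ 0 < X₂.leadingCoeff ∧ 0 < X₃.leadingCoeff ∧
    4 * X₁ * X₂ * X₃ = p * (X₂ * X₃ + X₃ * X₁ + X₁ * X₂)

theorem jacobiSym_neg_eq_neg_one {d e s : ℕ} (hd : 0 < d) (hs : s.Coprime (4 * d))
    (h : 4 * d ∣ e + s ^ 2) : jacobiSym (-d) e = -1 := by
  have hs2 : Odd s := by
    have : s.Coprime 2 := hs.coprime_dvd_right ⟨2 * d, by ring⟩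
    exact Nat.coprime_two_right.mp this
  have hsd : s.Coprime d := hs.coprime_dvd_right ⟨4, by ring⟩
  obtain ⟨k, hk⟩ := h
  have he : Odd e := by
    have h1 : Odd (s ^ 2) := hs2.pow
    have h2 : Even (e + s ^ 2) := ⟨2 * d * k, by rw [hk]; ring⟩
    exact (Nat.even_add'.mp h2).mpr h1
  obtain ⟨m, hm⟩ : ∃ m, 4 * d = m + 1 := ⟨4 * d - 1, by omega⟩
  have hmo : Odd m := by rw [Nat.odd_iff]; omega
  have hm3 : m % 4 = 3 := by omega
  have hmod : e % (4 * d) = (s ^ 2 * m) % (4 * d) := by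
    have : e ≡ s ^ 2 * m [MOD 4 * d] := by
      apply Nat.ModEq.add_right_cancel' (s ^ 2)
      have : s ^ 2 * m + s ^ 2 = 4 * d * s ^ 2 := by rw [hm]; ring
      rw [hk, this, Nat.ModEq]
      simp
    exact this
  have h1 : jacobiSym (-d) e = jacobiSym (-d) (s ^ 2 * m) := by
    rw [jacobiSym.mod_right _ he, jacobiSym.mod_right _ (hs2.pow.mul hmo)]
    simp only [Int.natAbs_neg, Int.natAbs_natCast, hmod]
  have h2 : jacobiSym (-d) s ^ 2 = 1 := by
    apply jacobiSym.sq_one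
    rw [Int.neg_gcd, Int.gcd_natCast_natCast]
    exact hsd.symm
  have h3 : jacobiSym d m = 1 := by
    have h4 : jacobiSym ((2 : ℤ) ^ 2) m = 1 := by
      apply jacobiSym.sq_one'
      have := (Nat.coprime_two_left.mpr hmo)
      exact_mod_cast this
    have h5 : jacobiSym ((2 : ℤ) ^ 2 * d) m = 1 := by
      rw [show (2 : ℤ) ^ 2 * d = 1 + m by norm_num; exact_mod_cast (by omega), jacobiSym.mod_left]
      rw [Int.add_emod_right, ← jacobiSym.mod_left, jacobiSym.one_left]
    rwa [jacobiSym.mul_left, h4, one_mul] at h5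
  have hm0 : NeZero m := ⟨by omega⟩
  have hs0 : NeZero s := ⟨by rintro rfl; simp at hs2⟩
  rw [h1, jacobiSym.mul_right, jacobiSym.pow_right, h2, one_mul, jacobiSym.neg _ hmo, h3,
    ZMod.χ₄_nat_three_mod_four hm3]
  norm_num

theorem false_of_dvd_add_sq {a d e s r : ℕ} (hd : 0 < d) (hs : s.Coprime (4 * d))
    (hr : r.Coprime e) (h : 4 * d ∣ e + s ^ 2) (h' : e ∣ r ^ 2 + 4 * a ^ 2 * d) : False := by
  have h1 : jacobiSym ((r : ℤ) ^ 2) e = 1 := jacobiSym.sq_one' (by exact_mod_cast hr)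
  have h2 : jacobiSym ((r : ℤ) ^ 2) e = jacobiSym ((2 * a : ℤ) ^ 2 * -d) e := by
    apply jacobiSym.mod_left'
    apply Int.ModEq.symm
    rw [Int.modEq_iff_dvd]
    convert Int.natCast_dvd_natCast.mpr h' using 1
    push_cast; ring
  rw [h2, jacobiSym.mul_left, jacobiSym_neg_eq_neg_one hd hs h, jacobiSym.pow_left] at h1
  nlinarith [sq_nonneg (jacobiSym (2 * a : ℤ) e)]

theorem exists_coprime_mul {y z : ℕ} (hy : 0 < y) :
    ∃ g a b, 0 < g ∧ y = g * a ∧ z = g * b ∧ a.Coprime b := by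
  obtain ⟨a, b, h, h1, h2⟩ := Nat.exists_coprime y z
  exact ⟨_, a, b, Nat.gcd_pos_of_pos_left _ hy, by rw [mul_comm]; exact h1, by rw [mul_comm]; exact h2, h⟩

theorem coprime_mul_add {a b : ℕ} (h : a.Coprime b) : (a * b).Coprime (a + b) :=
  Nat.Coprime.mul_left (by simpa using h) (by simpa using h.symm)

/-- The equation `4 / q² = 1 / (q² x) + 1 / y + 1 / z` has no solution with `y`, `z` prime to `q`. -/
theorem false_of_typeI {q x y z : ℕ} (hx : 0 < x) (hy : 0 < y) (hz : 0 < z)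
    (hyq : y.Coprime q) (hzq : z.Coprime q)
    (h : 4 * x * y * z = y * z + q ^ 2 * x * (y + z)) : False := by
  obtain ⟨g, a, b, hg, rfl, rfl, hab⟩ := exists_coprime_mul (z := z) hy
  have ha : 0 < a := Nat.pos_of_mul_pos_left hy
  have hb : 0 < b := Nat.pos_of_mul_pos_left hz
  have h1 : 4 * x * g * (a * b) = g * (a * b) + x * (q ^ 2 * (a + b)) := by
    apply Nat.eq_of_mul_eq_mul_left hg; linarith
  have haq : (a * b).Coprime (q ^ 2) :=
    (Nat.Coprime.mul_left (hyq.coprime_mul_left) (hzq.coprime_mul_left)).pow_right 2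
  have h2 : a * b ∣ x := by
    apply (haq.mul_right (coprime_mul_add hab)).dvd_of_dvd_mul_right
    rw [← Nat.dvd_add_right (Dvd.intro_left g rfl), ← h1]
    exact Dvd.intro_left _ rfl
  obtain ⟨d, rfl⟩ := h2
  have hd : 0 < d := Nat.pos_of_mul_pos_left hx
  have h3 : 4 * a * b * d * g = g + d * (q ^ 2 * (a + b)) := by
    apply Nat.eq_of_mul_eq_mul_left (Nat.mul_pos ha hb); linarith
  have h4 : d ∣ g := by
    rw [← Nat.dvd_add_left (Dvd.intro (q ^ 2 * (a + b)) rfl), ← h3]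
    exact ⟨4 * a * b * g, by ring⟩
  obtain ⟨c, rfl⟩ := h4
  have hc : 0 < c := Nat.pos_of_mul_pos_left hg
  have h5 : 4 * a * b * d * c = c + q ^ 2 * (a + b) := by
    apply Nat.eq_of_mul_eq_mul_left hd; linarith
  have hcq : c.Coprime (q ^ 2) := (hyq.coprime_mul_right.coprime_mul_left).pow_right 2
  have h6 : c ∣ a + b := by
    apply hcq.dvd_of_dvd_mul_left
    rw [← Nat.dvd_add_right (dvd_refl c), ← h5]
    exact Dvd.intro_left _ rfl
  obtain ⟨e, he⟩ := h6
  have h7 : 4 * a * b * d = 1 + q ^ 2 * e := by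
    apply Nat.eq_of_mul_eq_mul_left hc; rw [he] at h5; linarith
  refine false_of_dvd_add_sq (a := a) (e := e) (s := q * e) (r := 1) hd ?_ (Nat.coprime_one_left _)
    ⟨a * b * e, ?_⟩ ?_
  · apply Nat.Coprime.coprime_dvd_right (show 4 * d ∣ 4 * a * b * d from ⟨a * b, by ring⟩)
    rw [h7, show 1 + q ^ 2 * e = 1 + q * e * q by ring]
    simp
  · linear_combination e * h7.symm
  · zify at h7 he ⊢
    refine ⟨4 * a * d * c - q ^ 2, ?_⟩
    linear_combination 4 * a * d * he - h7

/-- For odd `q`, the equation `4 / q² = 1 / x + 1 / (q² y) + 1 / (q² z)` has no solution with `x`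
prime to `q`. -/
theorem false_of_typeII {q x y z : ℕ} (hx : 0 < x) (hy : 0 < y) (hz : 0 < z)
    (hq : Odd q) (hxq : x.Coprime q)
    (h : 4 * x * y * z = q ^ 2 * y * z + x * (y + z)) : False := by
  obtain ⟨g, a, b, hg, rfl, rfl, hab⟩ := exists_coprime_mul (z := z) hy
  have ha : 0 < a := Nat.pos_of_mul_pos_left hy
  have hb : 0 < b := Nat.pos_of_mul_pos_left hz
  have h1 : 4 * x * g * (a * b) = q ^ 2 * g * (a * b) + x * (a + b) := by
    apply Nat.eq_of_mul_eq_mul_left hg; linarith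
  have h2 : a * b ∣ x := by
    apply (coprime_mul_add hab).dvd_of_dvd_mul_right
    rw [← Nat.dvd_add_right (Dvd.intro_left (q ^ 2 * g) rfl), ← h1]
    exact Dvd.intro_left _ rfl
  obtain ⟨d, rfl⟩ := h2
  have hd : 0 < d := Nat.pos_of_mul_pos_left hx
  have h3 : 4 * a * b * d * g = q ^ 2 * g + d * (a + b) := by
    apply Nat.eq_of_mul_eq_mul_left (Nat.mul_pos ha hb); linarith
  have h4 : d ∣ g := by
    apply (hxq.coprime_mul_left.pow_right 2).dvd_of_dvd_mul_left
    rw [← Nat.dvd_add_left (Dvd.intro (a + b) rfl), ← h3]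
    exact ⟨4 * a * b * g, by ring⟩
  obtain ⟨c, rfl⟩ := h4
  have hc : 0 < c := Nat.pos_of_mul_pos_left hg
  have h5 : 4 * a * b * d * c = q ^ 2 * c + (a + b) := by
    apply Nat.eq_of_mul_eq_mul_left hd; linarith
  have h6 : c ∣ a + b := by
    rw [← Nat.dvd_add_right (Dvd.intro_left (q ^ 2) rfl), ← h5]
    exact Dvd.intro_left _ rfl
  obtain ⟨e, he⟩ := h6
  have h7 : 4 * a * b * d = e + q ^ 2 := by
    apply Nat.eq_of_mul_eq_mul_left hc; rw [he] at h5; linarith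
  have h8 : (4 * (a * b * d)).Coprime q :=
    Nat.Coprime.mul_left (show (2 ^ 2).Coprime q from (Nat.coprime_two_left.mpr hq).pow_left 2) hxq
  refine false_of_dvd_add_sq (a := a) (e := e) (s := q) (r := q) hd ?_ ?_
    ⟨a * b, ?_⟩ ?_
  · exact (h8.coprime_dvd_left ⟨a * b, by ring⟩).symm
  · rw [show 4 * (a * b * d) = e + q * q by linarith] at h8
    simpa using h8.symm
  · linarith
  · zify at h7 he ⊢
    refine ⟨4 * a * d * c - 1, ?_⟩
    linear_combination 4 * a * d * he - h7

theorem false_of_dvd_or_coprime {q x y z : ℕ} (hx : 0 < x) (hy : 0 < y) (hz : 0 < z)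
    (hq : q.Prime) (hq2 : Odd q) (hxq : q ^ 2 ∣ x ∨ x.Coprime q) (hyq : q ^ 2 ∣ y ∨ y.Coprime q)
    (hzq : q ^ 2 ∣ z ∨ z.Coprime q) (h : 4 * x * y * z = q ^ 2 * (y * z + z * x + x * y)) :
    False := by
  have hn : 0 < q ^ 2 := pow_pos hq.pos 2
  have one {x y z : ℕ} (hx : 0 < x) (hy : 0 < y) (hz : 0 < z) (hxq : q ^ 2 ∣ x)
      (hyq : y.Coprime q) (hzq : z.Coprime q)
      (h : 4 * x * y * z = q ^ 2 * (y * z + z * x + x * y)) : False := by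
    obtain ⟨x, rfl⟩ := hxq
    refine false_of_typeI (Nat.pos_of_mul_pos_left hx) hy hz hyq hzq ?_
    apply Nat.eq_of_mul_eq_mul_left hn; linarith
  have two {x y z : ℕ} (hx : 0 < x) (hy : 0 < y) (hz : 0 < z) (hxq : x.Coprime q)
      (hyq : q ^ 2 ∣ y) (hzq : q ^ 2 ∣ z)
      (h : 4 * x * y * z = q ^ 2 * (y * z + z * x + x * y)) : False := by
    obtain ⟨y, rfl⟩ := hyq
    obtain ⟨z, rfl⟩ := hzq
    refine false_of_typeII hx (Nat.pos_of_mul_pos_left hy) (Nat.pos_of_mul_pos_left hz) hq2 hxq ?_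
    apply Nat.eq_of_mul_eq_mul_left hn
    apply Nat.eq_of_mul_eq_mul_left hn; linarith
  rcases hxq with hxq | hxq <;> rcases hyq with hyq | hyq <;> rcases hzq with hzq | hzq
  · obtain ⟨x, rfl⟩ := hxq
    obtain ⟨y, rfl⟩ := hyq
    obtain ⟨z, rfl⟩ := hzq
    replace hx := Nat.pos_of_mul_pos_left hx
    replace hy := Nat.pos_of_mul_pos_left hy
    replace hz := Nat.pos_of_mul_pos_left hz
    have h' : 4 * x * y * z = y * z + z * x + x * y := by
      apply Nat.eq_of_mul_eq_mul_left (pow_pos hn 3); linarith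
    nlinarith [Nat.le_mul_of_pos_left (y * z) hx, Nat.le_mul_of_pos_left (z * x) hy,
      Nat.le_mul_of_pos_left (x * y) hz, Nat.mul_pos (Nat.mul_pos hx hy) hz]
  · exact two hz hx hy hzq hxq hyq (by linarith)
  · exact two hy hz hx hyq hzq hxq (by linarith)
  · exact one hx hy hz hxq hyq hzq h
  · exact two hx hy hz hxq hyq hzq h
  · exact one hy hz hx hyq hzq hxq (by linarith)
  · exact one hz hx hy hzq hxq hyq (by linarith)
  · have h4 : Nat.Coprime 4 q :=
      show (2 ^ 2).Coprime q from (Nat.coprime_two_left.mpr hq2).pow_left 2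
    have : (4 * x * y * z).Coprime q := ((h4.mul_left hxq).mul_left hyq).mul_left hzq
    rw [h] at this
    have := this.coprime_mul_right
    simp [hq.ne_one] at this

theorem eventually_eval_pos {P : ℤ[X]} (hP : 0 < P.leadingCoeff) :
    ∃ N : ℤ, ∀ t ≥ N, 0 < P.eval t := by
  have h : ∀ᶠ x : ℝ in Filter.atTop, 0 < (P.map (Int.castRingHom ℝ)).eval x := by
    have hl : (P.map (Int.castRingHom ℝ)).leadingCoeff = P.leadingCoeff :=
      leadingCoeff_map_of_injective (RingHom.injective_int _) _
    have hl' : 0 < (P.map (Int.castRingHom ℝ)).leadingCoeff := by rw [hl]; exact_mod_cast hP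
    rcases lt_or_ge 0 (P.map (Int.castRingHom ℝ)).degree with hd | hd
    · exact (tendsto_atTop_of_leadingCoeff_nonneg _ hd hl'.le).eventually_gt_atTop 0
    · rw [eq_C_of_degree_le_zero hd, leadingCoeff_C] at hl'
      rw [eq_C_of_degree_le_zero hd]
      exact .of_forall fun x => by rwa [eval_C]
  obtain ⟨N, hN⟩ := Filter.eventually_atTop.mp h
  refine ⟨⌈N⌉, fun t ht => ?_⟩
  have := hN t (Int.ceil_le.mp ht)
  rw [eval_intCast_map] at this
  simpa using this

theorem exists_pow_mul_eq_linear_mul_add {R : Type*} [CommRing R] (a b : R) (P : R[X]) :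
    ∃ k Q r, C (a ^ k) * P = (C a * X + C b) * Q + C r := by
  induction P using Polynomial.induction_on' with
  | add P P' h h' =>
    obtain ⟨k, Q, r, h⟩ := h
    obtain ⟨k', Q', r', h'⟩ := h'
    refine ⟨k + k', C (a ^ k') * Q + C (a ^ k) * Q', a ^ k' * r + a ^ k * r', ?_⟩
    simp only [pow_add, C_mul, C_add] at *
    linear_combination C (a ^ k') * h + C (a ^ k) * h'
  | monomial n c =>
    induction n with
    | zero => exact ⟨0, 0, c, by simp⟩
    | succ n ih =>
      obtain ⟨k, Q, r, h⟩ := ih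
      refine ⟨k + 1, C a * X * Q + C r, -(b * r), ?_⟩
      rw [← monomial_mul_X]
      simp only [pow_succ, C_mul, C_neg] at *
      linear_combination C a * X * h

theorem eval_linear_dvd_or_exists {a b : ℤ} (ha : a ≠ 0) (hab : IsCoprime a b) (P : ℤ[X]) :
    (∀ t : ℤ, a * t + b ∣ P.eval t) ∨
      ∃ r ≠ 0, ∀ q t : ℤ, q ∣ a * t + b → q ∣ P.eval t → q ∣ r := by
  have hp : Prime (C a * X + C b : ℤ[X]) :=
    (irreducible_C_mul_X_add_C ha hab.isRelPrime).prime
  obtain ⟨k, Q, r, h⟩ := exists_pow_mul_eq_linear_mul_add a b P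
  by_cases hr : r = 0
  · left
    have h1 : C a * X + C b ∣ C (a ^ k) * P := ⟨Q, by simpa [hr] using h⟩
    rcases hp.dvd_or_dvd h1 with h2 | ⟨S, rfl⟩
    · have := natDegree_le_of_dvd h2 (C_ne_zero.mpr (pow_ne_zero k ha))
      rw [natDegree_linear ha, natDegree_C] at this
      omega
    · intro t
      simp
  · refine .inr ⟨r, hr, fun q t h1 h2 => ?_⟩
    have h3 := congrArg (eval t) h
    simp only [eval_mul, eval_add, eval_C, eval_X] at h3
    exact (dvd_add_right (h1.mul_right _)).mp (h3 ▸ h2.mul_left _)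

theorem exists_bound_dvd_or_coprime {a b : ℤ} (ha : a ≠ 0) (hab : IsCoprime a b) {P : ℤ[X]}
    (hP : 0 < P.leadingCoeff) :
    ∃ N : ℕ, ∀ (q : ℕ) (t : ℤ), q.Prime → N ≤ q → N ≤ t → (q : ℤ) ^ 2 = a * t + b →
      ∃ x : ℕ, P.eval t = x ∧ 0 < x ∧ (q ^ 2 ∣ x ∨ x.Coprime q) := by
  obtain ⟨M, hM⟩ := eventually_eval_pos hP
  obtain ⟨R, hR⟩ : ∃ R : ℕ, (∀ t : ℤ, a * t + b ∣ P.eval t) ∨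
      ∀ q : ℕ, R < q → ∀ t : ℤ, (q : ℤ) ∣ a * t + b → ¬ (q : ℤ) ∣ P.eval t := by
    rcases eval_linear_dvd_or_exists ha hab P with h | ⟨r, hr, h⟩
    · exact ⟨0, .inl h⟩
    · refine ⟨r.natAbs, .inr fun q hq t h1 h2 => ?_⟩
      have := Nat.le_of_dvd (Int.natAbs_pos.mpr hr) (Int.natCast_dvd.mp (h q t h1 h2))
      omega
  refine ⟨M.natAbs + R + 1, fun q t hq hqN htN h => ?_⟩
  have hpos := hM t (by omega)
  lift P.eval t to ℕ using hpos.le with x hx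
  refine ⟨x, rfl, by exact_mod_cast hpos, ?_⟩
  rcases hR with hR | hR
  · left
    have := hR t
    rw [← hx, ← h] at this
    exact_mod_cast this
  · right
    have := hR q (by omega) t (by rw [← h, sq]; exact Dvd.intro_left _ rfl)
    rw [← hx] at this
    rw [Nat.coprime_comm, hq.coprime_iff_not_dvd]
    exact_mod_cast this

theorem stmt_8 (a b : ℤ) (ha : 0 < a) (hab : Int.gcd a b = 1)
    (h : IsEgyptian3Poly (Polynomial.C a * Polynomial.X + Polynomial.C b)) :
    ¬ ∃ c : ℤ, c ^ 2 ≡ b [ZMOD a] := by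
  rintro ⟨c, hc⟩
  obtain ⟨X₁, X₂, X₃, h₁, h₂, h₃, h⟩ := h
  have hab' : IsCoprime a b := Int.isCoprime_iff_gcd_eq_one.mpr hab
  obtain ⟨N₁, H₁⟩ := exists_bound_dvd_or_coprime ha.ne' hab' h₁
  obtain ⟨N₂, H₂⟩ := exists_bound_dvd_or_coprime ha.ne' hab' h₂
  obtain ⟨N₃, H₃⟩ := exists_bound_dvd_or_coprime ha.ne' hab' h₃
  obtain ⟨m, hm⟩ := hc.dvd
  have hca : IsCoprime c a := by
    have : IsCoprime (c ^ 2) a := by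
      rw [show c ^ 2 = b + a * (-m) by linarith]
      exact hab'.symm.add_mul_left_left _
    exact (IsCoprime.pow_left_iff two_pos).mp this
  lift a to ℕ using ha.le
  obtain ⟨q, hqN, hq, hqc⟩ := Nat.forall_exists_prime_gt_and_zmodEq
    (a * (N₁ + N₂ + N₃) + b.natAbs + N₁ + N₂ + N₃ + 2) (by omega) hca
  obtain ⟨t, ht⟩ := ((hqc.pow 2).trans hc).symm.dvd
  have ht' : (q : ℤ) ^ 2 = a * t + b := by linarith
  have htN : (N₁ + N₂ + N₃ : ℤ) ≤ t := by
    have h0 : (a * (N₁ + N₂ + N₃) + b.natAbs : ℤ) < q := by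
      rw [gt_iff_lt, ← Nat.cast_lt (α := ℤ)] at hqN
      simp only [Nat.cast_add, Nat.cast_mul] at hqN
      linarith
    have h1 : (q : ℤ) ≤ q ^ 2 := by exact_mod_cast Nat.le_self_pow two_ne_zero q
    have h2 : b ≤ b.natAbs := Int.le_natAbs
    by_contra! h3
    have := mul_le_mul_of_nonneg_left h3.le ha.le
    linarith
  obtain ⟨x, hx, hx0, hxq⟩ := H₁ q t hq (by omega) (by omega) ht'
  obtain ⟨y, hy, hy0, hyq⟩ := H₂ q t hq (by omega) (by omega) ht'
  obtain ⟨z, hz, hz0, hzq⟩ := H₃ q t hq (by omega) (by omega) ht'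
  refine false_of_dvd_or_coprime hx0 hy0 hz0 hq (hq.odd_of_ne_two (by omega)) hxq hyq hzq ?_
  have := congrArg (eval t) h
  simp only [eval_mul, eval_add, eval_C, eval_X, eval_ofNat, hx, hy, hz, ← ht'] at this
  exact_mod_cast this
end

section
/- Let p ∈ ℤ[X] be irreducible of degree 1 with positive leading coefficient, and let A, B, C, D ∈ ℤ[X] each have positive leading coefficient, with deg B ≤ deg A, p not dividing A·B·D, and 4ABCD = A + B + pC. Then the tuple (deg A, deg B, deg C, deg D) is one of (1,0,0,0), (0,0,0,1), (1,0,1,0). -/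
open Polynomial

theorem Polynomial.natDegree_add_of_leadingCoeff_pos {P Q : ℤ[X]}
    (hP : 0 < P.leadingCoeff) (hQ : 0 < Q.leadingCoeff) :
    (P + Q).natDegree = max P.natDegree Q.natDegree := by
  have hP0 : P ≠ 0 := leadingCoeff_ne_zero.mp hP.ne'
  have hQ0 : Q ≠ 0 := leadingCoeff_ne_zero.mp hQ.ne'
  have h := degree_add_eq_of_leadingCoeff_add_ne_zero (add_pos hP hQ).ne'
  rw [degree_eq_natDegree hP0, degree_eq_natDegree hQ0] at h
  exact natDegree_eq_of_degree_eq_some (by rw [h]; norm_cast)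

theorem Polynomial.leadingCoeff_add_pos {P Q : ℤ[X]}
    (hP : 0 < P.leadingCoeff) (hQ : 0 < Q.leadingCoeff) :
    0 < (P + Q).leadingCoeff := by
  rcases lt_trichotomy P.degree Q.degree with h | h | h
  · rwa [leadingCoeff_add_of_degree_lt h]
  · rw [leadingCoeff_add_of_degree_eq h (add_pos hP hQ).ne']
    exact add_pos hP hQ
  · rwa [leadingCoeff_add_of_degree_lt' h]

theorem stmt_9 (p A B C D : Polynomial ℤ)
    (hp : Irreducible p) (hpdeg : p.natDegree = 1) (hplead : 0 < p.leadingCoeff)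
    (hA : 0 < A.leadingCoeff) (hB : 0 < B.leadingCoeff)
    (hC : 0 < C.leadingCoeff) (hD : 0 < D.leadingCoeff)
    (hBA : B.natDegree ≤ A.natDegree)
    (hndvd : ¬ p ∣ A * B * D)
    (heq : 4 * A * B * C * D = A + B + p * C) :
    (A.natDegree = 1 ∧ B.natDegree = 0 ∧ C.natDegree = 0 ∧ D.natDegree = 0) ∨
    (A.natDegree = 0 ∧ B.natDegree = 0 ∧ C.natDegree = 0 ∧ D.natDegree = 1) ∨
    (A.natDegree = 1 ∧ B.natDegree = 0 ∧ C.natDegree = 1 ∧ D.natDegree = 0) := by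
  have hA0 : A ≠ 0 := leadingCoeff_ne_zero.mp hA.ne'
  have hB0 : B ≠ 0 := leadingCoeff_ne_zero.mp hB.ne'
  have hC0 : C ≠ 0 := leadingCoeff_ne_zero.mp hC.ne'
  have hD0 : D ≠ 0 := leadingCoeff_ne_zero.mp hD.ne'
  have hpC : 0 < (p * C).leadingCoeff := by
    rw [leadingCoeff_mul]
    exact mul_pos hplead hC
  have hpCdeg : (p * C).natDegree = 1 + C.natDegree := by
    rw [natDegree_mul hp.ne_zero hC0, hpdeg]
  have hAB : 0 < (A + B).leadingCoeff := leadingCoeff_add_pos hA hB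
  have hABdeg : (A + B).natDegree = A.natDegree := by
    rw [natDegree_add_of_leadingCoeff_pos hA hB, max_eq_left hBA]
  have hdeg : A.natDegree + B.natDegree + C.natDegree + D.natDegree =
      max A.natDegree (1 + C.natDegree) := by
    have h4 : (4 * A * B * C * D).natDegree =
        A.natDegree + B.natDegree + C.natDegree + D.natDegree := by
      have h : 4 * A * B * C * D = Polynomial.C 4 * (A * B * C * D) := by
        rw [map_ofNat]
        ring
      rw [h, natDegree_C_mul (by norm_num), natDegree_mul (by simp [*]) hD0,
        natDegree_mul (by simp [*]) hC0, natDegree_mul hA0 hB0]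
    rw [← h4, heq, natDegree_add_of_leadingCoeff_pos hAB hpC, hABdeg, hpCdeg]
  rcases le_or_gt (1 + C.natDegree) A.natDegree with hCA | hCA
  · have hfac : A * (4 * B * C * D - 1) = B + p * C := by linear_combination heq
    have hpos : 0 < (B + p * C).leadingCoeff := leadingCoeff_add_pos hB hpC
    have hne : A * (4 * B * C * D - 1) ≠ 0 := by
      rw [hfac]
      exact leadingCoeff_ne_zero.mp hpos.ne'
    have h := congrArg natDegree hfac
    rw [natDegree_mul hA0 (right_ne_zero_of_mul hne),
      natDegree_add_of_leadingCoeff_pos hB hpC, hpCdeg] at h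
    omega
  · have hfac : C * (4 * A * B * D - p) = A + B := by linear_combination heq
    have hne : C * (4 * A * B * D - p) ≠ 0 := by
      rw [hfac]
      exact leadingCoeff_ne_zero.mp hAB.ne'
    have h := congrArg natDegree hfac
    rw [natDegree_mul hC0 (right_ne_zero_of_mul hne), hABdeg] at h
    omega
end

section
/- Let p ∈ ℤ[X] be irreducible of degree 1 with positive leading coefficient. Then 4/p is 3-Egyptian over ℤ[X] if and only if there exist positive integers (viewed as constant polynomials where needed) satisfying at least one of the following seven conditions, where all polynomial divisibilities are in ℤ[X]: (1a) ∃ B C D, (4BCD − 1) ∣ (B + C·p); (1b) ∃ A B E, (4AB) ∣ (p + E) and E ∣ (A + B) in ℤ; (1c) ∃ B D E, (4BDE) ∣ (p + E + 4B²D); (2a) ∃ A B E, (4AB) ∣ (E·p + 1) and E ∣ (A + B) in ℤ; (2b) ∃ B C F, (4BC) ∣ (p + F) and F ∣ (B·p + C); (2c) ∃ B D F, (4BD) ∣ (p + F) and F ∣ (4B²D + 1) in ℤ; (2d) ∃ C D F with gcd(4CD, F) = 1, (4CD) ∣ (p + F) and F ∣ (p² + 4C²D). -/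
namespace Polynomial

theorem leadingCoeff_mul_pos {q r : ℤ[X]} (hq : 0 < q.leadingCoeff) (hr : 0 < r.leadingCoeff) :
    0 < (q * r).leadingCoeff := by
  rw [leadingCoeff_mul]
  exact mul_pos hq hr

theorem leadingCoeff_pos_of_mul {q r s : ℤ[X]} (hs : 0 < s.leadingCoeff)
    (hq : 0 < q.leadingCoeff) (h : q * r = s) : 0 < r.leadingCoeff := by
  rw [← h, leadingCoeff_mul] at hs
  exact pos_of_mul_pos_right hs hq.le

theorem ne_zero_of_leadingCoeff_pos {q : ℤ[X]} (hq : 0 < q.leadingCoeff) : q ≠ 0 := by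
  rintro rfl
  simp at hq

theorem natDegree_mul_of_leadingCoeff_pos {q r : ℤ[X]} (hq : 0 < q.leadingCoeff)
    (hr : 0 < r.leadingCoeff) : (q * r).natDegree = q.natDegree + r.natDegree :=
  natDegree_mul (ne_zero_of_leadingCoeff_pos hq) (ne_zero_of_leadingCoeff_pos hr)

theorem leadingCoeff_add_pos_and_natDegree_add {q r : ℤ[X]} (hq : 0 < q.leadingCoeff)
    (hr : 0 < r.leadingCoeff) :
    0 < (q + r).leadingCoeff ∧ (q + r).natDegree = max q.natDegree r.natDegree := by
  rcases lt_trichotomy q.natDegree r.natDegree with h | h | h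
  · rw [leadingCoeff_add_of_degree_lt (degree_lt_degree h),
      natDegree_add_eq_right_of_natDegree_lt h, max_eq_right h.le]
    exact ⟨hr, rfl⟩
  · have hd : q.degree = r.degree := by
      rw [degree_eq_natDegree (ne_zero_of_leadingCoeff_pos hq),
        degree_eq_natDegree (ne_zero_of_leadingCoeff_pos hr), h]
    have hne : q.leadingCoeff + r.leadingCoeff ≠ 0 := by positivity
    refine ⟨?_, ?_⟩
    · rw [leadingCoeff_add_of_degree_eq hd hne]
      positivity
    · exact natDegree_eq_of_degree_eq_some (by
        rw [degree_add_eq_of_leadingCoeff_add_ne_zero hne, hd, max_self, h, max_self,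
          degree_eq_natDegree (ne_zero_of_leadingCoeff_pos hr)])
  · rw [leadingCoeff_add_of_degree_lt' (degree_lt_degree h),
      natDegree_add_eq_left_of_natDegree_lt h, max_eq_left h.le]
    exact ⟨hq, rfl⟩

theorem leadingCoeff_add_pos_s11 {q r : ℤ[X]} (hq : 0 < q.leadingCoeff) (hr : 0 < r.leadingCoeff) :
    0 < (q + r).leadingCoeff :=
  (leadingCoeff_add_pos_and_natDegree_add hq hr).1

theorem natDegree_add_of_leadingCoeff_pos_s11 {q r : ℤ[X]} (hq : 0 < q.leadingCoeff)
    (hr : 0 < r.leadingCoeff) : (q + r).natDegree = max q.natDegree r.natDegree :=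
  (leadingCoeff_add_pos_and_natDegree_add hq hr).2

theorem leadingCoeff_C_pos {k : ℤ} (hk : 0 < k) : 0 < (C k).leadingCoeff := by
  rwa [leadingCoeff_C]

theorem leadingCoeff_four_pos : 0 < (4 : ℤ[X]).leadingCoeff :=
  leadingCoeff_C_pos (k := 4) (by norm_num)

theorem natDegree_four : (4 : ℤ[X]).natDegree = 0 :=
  natDegree_C (4 : ℤ)

theorem exists_eq_C_of_leadingCoeff_pos {q : ℤ[X]} (hq : 0 < q.leadingCoeff)
    (h : q.natDegree = 0) : ∃ k : ℤ, 0 < k ∧ q = C k := by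
  obtain ⟨k, rfl⟩ := natDegree_eq_zero.mp h
  exact ⟨k, by rwa [leadingCoeff_C] at hq, rfl⟩

theorem eq_one_of_isUnit_of_leadingCoeff_pos {u : ℤ[X]} (hu : IsUnit u)
    (h : 0 < u.leadingCoeff) : u = 1 := by
  obtain ⟨k, hk, rfl⟩ := isUnit_iff.mp hu
  rw [leadingCoeff_C] at h
  rcases Int.isUnit_iff.mp hk with rfl | rfl
  · simp
  · norm_num at h

theorem eq_of_dvd_dvd_of_leadingCoeff_pos {q r : ℤ[X]} (hq : 0 < q.leadingCoeff)
    (hr : 0 < r.leadingCoeff) (h : q ∣ r) (h' : r ∣ q) : q = r := by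
  obtain ⟨u, hu⟩ := associated_of_dvd_dvd h h'
  have := eq_one_of_isUnit_of_leadingCoeff_pos u.isUnit (leadingCoeff_pos_of_mul hr hq hu)
  rw [← hu, this, mul_one]

theorem eq_one_or_leadingCoeff_sub_one_pos {q : ℤ[X]} (hq : 0 < q.leadingCoeff) :
    q = 1 ∨ 0 < (q - 1).leadingCoeff := by
  by_cases h : q.natDegree = 0
  · obtain ⟨k, hk, rfl⟩ := exists_eq_C_of_leadingCoeff_pos hq h
    rcases eq_or_ne k 1 with rfl | hk1
    · simp
    · right
      rw [← C_1, ← C_sub]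
      exact leadingCoeff_C_pos (by lia)
  · right
    rwa [leadingCoeff_sub_of_degree_lt]
    rw [degree_one]
    exact natDegree_pos_iff_degree_pos.mp (Nat.pos_of_ne_zero h)

theorem exists_pos_reduced_factors {q r : ℤ[X]} (hq : 0 < q.leadingCoeff)
    (hr : 0 < r.leadingCoeff) :
    ∃ g q' r' : ℤ[X], 0 < g.leadingCoeff ∧ 0 < q'.leadingCoeff ∧ 0 < r'.leadingCoeff ∧
      q = g * q' ∧ r = g * r' ∧ IsRelPrime q' r' := by
  obtain ⟨q', r', g, hrel, hgq, hgr⟩ :=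
    UniqueFactorizationMonoid.exists_reduced_factors q (ne_zero_of_leadingCoeff_pos hq) r
  have hg : g ≠ 0 := by
    rintro rfl
    rw [← hgq, zero_mul, leadingCoeff_zero] at hq
    exact hq.false
  rcases lt_or_gt_of_ne (leadingCoeff_ne_zero.mpr hg) with h | h
  · have h' : 0 < (-g).leadingCoeff := by
      rw [leadingCoeff_neg]
      lia
    exact ⟨-g, -q', -r', h', leadingCoeff_pos_of_mul hq h' (by rw [neg_mul_neg, hgq]),
      leadingCoeff_pos_of_mul hr h' (by rw [neg_mul_neg, hgr]), by rw [neg_mul_neg, hgq],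
      by rw [neg_mul_neg, hgr], hrel.neg_neg⟩
  · exact ⟨g, q', r', h, leadingCoeff_pos_of_mul hq h hgq, leadingCoeff_pos_of_mul hr h hgr,
      hgq.symm, hgr.symm, hrel⟩

end Polynomial

open Polynomial

theorem exists_factorization_of_unit_fraction_identity {r s x y z : ℤ[X]}
    (hx : 0 < x.leadingCoeff) (hy : 0 < y.leadingCoeff) (hz : 0 < z.leadingCoeff)
    (hrx : IsRelPrime r x) (hsy : IsRelPrime s y) (hsz : IsRelPrime s z)
    (h : 4 * x * y * z = r * (y * z) + s * (x * z + x * y)) :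
    ∃ a b c d : ℤ[X], 0 < a.leadingCoeff ∧ 0 < b.leadingCoeff ∧ 0 < c.leadingCoeff ∧
      0 < d.leadingCoeff ∧ c ∣ a + b ∧ 4 * a * b * c * d = r * c + s * (a + b) := by
  obtain ⟨g, b, c, hg, hb, hc, rfl, rfl, hbc⟩ := exists_pos_reduced_factors hx hy
  obtain ⟨d, a, w, hd, ha, hw, rfl, rfl, haw⟩ := exists_pos_reduced_factors hg hz
  have hd0 := ne_zero_of_leadingCoeff_pos hd
  have ha0 := ne_zero_of_leadingCoeff_pos ha
  have hw0 := ne_zero_of_leadingCoeff_pos hw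
  have key : 4 * d * a * b * c * w = r * c * w + s * b * w + s * a * b * c := by
    apply mul_left_cancel₀ (mul_ne_zero (pow_ne_zero 2 hd0) ha0)
    linear_combination h
  have hrb : IsRelPrime b r := hrx.symm.of_mul_left_right
  have hsc : IsRelPrime c s := hsy.symm.of_mul_left_right
  have hsw : IsRelPrime w s := hsz.symm.of_mul_left_right
  have hwbc : w ∣ b * c := by
    refine haw.symm.dvd_of_dvd_mul_left (hsw.dvd_of_dvd_mul_left ?_)
    exact ⟨4 * d * a * b * c - r * c - s * b, by linear_combination -key⟩
  have hbw : b ∣ w := by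
    refine hbc.dvd_of_dvd_mul_left (hrb.dvd_of_dvd_mul_left ?_)
    exact ⟨4 * d * a * c * w - s * w - s * a * c, by linear_combination -key⟩
  have hcw : c ∣ w := by
    refine hbc.symm.dvd_of_dvd_mul_left (hsc.dvd_of_dvd_mul_left ?_)
    exact ⟨4 * d * a * b * w - r * w - s * a * b, by linear_combination -key⟩
  obtain rfl := eq_of_dvd_dvd_of_leadingCoeff_pos hw (leadingCoeff_mul_pos hb hc) hwbc
    (hbc.mul_dvd hbw hcw)
  have key' : 4 * a * b * c * d = r * c + s * (a + b) := by
    apply mul_left_cancel₀ hw0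
    linear_combination key
  refine ⟨a, b, c, d, ha, hb, hc, hd, hsc.dvd_of_dvd_mul_left ?_, key'⟩
  exact ⟨4 * a * b * d - r, by linear_combination -key'⟩

theorem unit_fraction_sum_ne_four {x y z : ℤ[X]}
    (hx : 0 < x.leadingCoeff) (hy : 0 < y.leadingCoeff) (hz : 0 < z.leadingCoeff) :
    4 * x * y * z ≠ y * z + z * x + x * y := by
  intro h
  have add_sub_one_mul_pos : ∀ {t q u : ℤ[X]},
      0 < t.leadingCoeff → 0 < q.leadingCoeff → 0 < u.leadingCoeff →
      0 < (t + (q - 1) * u).leadingCoeff := by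
    intro t q u ht hq hu
    rcases eq_one_or_leadingCoeff_sub_one_pos hq with rfl | hq
    · simpa using ht
    · exact leadingCoeff_add_pos_s11 ht (leadingCoeff_mul_pos hq hu)
  have hpos := add_sub_one_mul_pos (add_sub_one_mul_pos (add_sub_one_mul_pos
    (leadingCoeff_mul_pos (leadingCoeff_mul_pos hx hy) hz) hx
    (leadingCoeff_mul_pos hy hz)) hy (leadingCoeff_mul_pos hz hx)) hz (leadingCoeff_mul_pos hx hy)
  refine ne_zero_of_leadingCoeff_pos hpos ?_
  linear_combination h

theorem not_dvd_sq_add_const {q f : ℤ[X]} {k : ℤ} (hk : 0 < k) (hf : f.natDegree = 1) :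
    ¬ f ∣ q ^ 2 + C k := by
  rintro ⟨g, hg⟩
  have hf' : (f.map (Int.castRingHom ℚ)).degree = 1 := by
    rw [degree_map_eq_of_injective Int.cast_injective]
    exact (degree_eq_iff_natDegree_eq_of_pos one_pos).mpr hf
  obtain ⟨t, ht⟩ := exists_root_of_degree_eq_one hf'
  have hev := congrArg (fun u : ℤ[X] => (u.map (Int.castRingHom ℚ)).eval t) hg
  simp only [Polynomial.map_add, Polynomial.map_pow, Polynomial.map_mul, eval_add, eval_pow,
    eval_mul, ht.eq_zero, zero_mul, map_C, eval_C] at hev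
  have hk' : (0 : ℚ) < Int.castRingHom ℚ k := by simpa using hk
  nlinarith [sq_nonneg ((q.map (Int.castRingHom ℚ)).eval t)]

section Necessity

variable {p : ℤ[X]}

theorem conditions_of_dvd_one_of_natDegree_le (hp : Irreducible p) (hpdeg : p.natDegree = 1)
    (hplead : 0 < p.leadingCoeff) {a b c d : ℤ[X]}
    (ha : 0 < a.leadingCoeff) (hb : 0 < b.leadingCoeff) (hc : 0 < c.leadingCoeff)
    (hd : 0 < d.leadingCoeff) (hdvd : c ∣ a + b) (h : 4 * a * b * c * d = c + p * (a + b))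
    (hba : b.natDegree ≤ a.natDegree) :
    (∃ A B E : ℤ, 0 < A ∧ 0 < B ∧ 0 < E ∧ C (4 * A * B) ∣ (C E * p + 1) ∧ E ∣ (A + B)) ∨
    (∃ B K F : ℤ, 0 < B ∧ 0 < K ∧ 0 < F ∧ C (4 * B * K) ∣ (p + C F) ∧ C F ∣ (C B * p + C K)) ∨
    (∃ B D F : ℤ, 0 < B ∧ 0 < D ∧ 0 < F ∧ C (4 * B * D) ∣ (p + C F) ∧ F ∣ (4 * B ^ 2 * D + 1)) ∨
    (∃ K D F : ℤ, 0 < K ∧ 0 < D ∧ 0 < F ∧ Int.gcd (4 * K * D) F = 1 ∧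
      C (4 * K * D) ∣ (p + C F) ∧ C F ∣ (p ^ 2 + C (4 * K ^ 2 * D))) := by
  obtain ⟨e, he⟩ := hdvd
  have hab := leadingCoeff_add_pos_s11 ha hb
  have hepos : 0 < e.leadingCoeff := leadingCoeff_pos_of_mul hab hc he.symm
  have hc0 := ne_zero_of_leadingCoeff_pos hc
  obtain ⟨f, hf⟩ : ∃ f, f = 4 * b * c * d - p := ⟨_, rfl⟩
  have hf' : 4 * b * c * d = p + f := by rw [hf]; ring
  have haf : a * f = p * b + c := by rw [hf]; linear_combination h
  have hpb := leadingCoeff_mul_pos hplead hb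
  have hfpos : 0 < f.leadingCoeff := leadingCoeff_pos_of_mul (leadingCoeff_add_pos_s11 hpb hc) ha haf
  have habd : 4 * a * b * d = e * p + 1 := by
    apply mul_left_cancel₀ hc0
    linear_combination h + p * he
  have hef : e * f = 4 * b ^ 2 * d + 1 := by
    apply mul_left_cancel₀ hc0
    rw [hf]
    linear_combination (p - 4 * b * c * d) * he + h
  have hff : f * (4 * a * c * d - p) = p ^ 2 + 4 * c ^ 2 * d := by
    linear_combination (4 * c * d) * haf + p * hf'
  have d1 := congrArg natDegree he
  have d2 := congrArg natDegree haf
  have d3 := congrArg natDegree h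
  have h4a := leadingCoeff_mul_pos leadingCoeff_four_pos ha
  have h4ab := leadingCoeff_mul_pos h4a hb
  have h4abc := leadingCoeff_mul_pos h4ab hc
  rw [natDegree_add_of_leadingCoeff_pos_s11 ha hb, natDegree_mul_of_leadingCoeff_pos hc hepos] at d1
  rw [natDegree_add_of_leadingCoeff_pos_s11 hpb hc, natDegree_mul_of_leadingCoeff_pos hplead hb,
    natDegree_mul_of_leadingCoeff_pos ha hfpos] at d2
  rw [natDegree_add_of_leadingCoeff_pos_s11 hc (leadingCoeff_mul_pos hplead hab),
    natDegree_mul_of_leadingCoeff_pos hplead hab, natDegree_add_of_leadingCoeff_pos_s11 ha hb,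
    natDegree_mul_of_leadingCoeff_pos h4abc hd, natDegree_mul_of_leadingCoeff_pos h4ab hc,
    natDegree_mul_of_leadingCoeff_pos h4a hb,
    natDegree_mul_of_leadingCoeff_pos leadingCoeff_four_pos ha, natDegree_four] at d3
  have hcases : (a.natDegree = 0 ∧ b.natDegree = 0 ∧ c.natDegree = 0 ∧ e.natDegree = 0) ∨
      (b.natDegree = 0 ∧ c.natDegree = 0 ∧ f.natDegree = 0) ∨
      (b.natDegree = 0 ∧ d.natDegree = 0 ∧ e.natDegree = 0 ∧ f.natDegree = 0) ∨
      (c.natDegree = 0 ∧ d.natDegree = 0 ∧ (f.natDegree = 0 ∨ f.natDegree = 1)) := by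
    lia
  rcases hcases with ⟨ga, gb, gc, ge⟩ | ⟨gb, gc, gf⟩ | ⟨gb, gd, ge, gf⟩ | ⟨gc, gd, gf | gf⟩
  · obtain ⟨A, hA, rfl⟩ := exists_eq_C_of_leadingCoeff_pos ha ga
    obtain ⟨B, hB, rfl⟩ := exists_eq_C_of_leadingCoeff_pos hb gb
    obtain ⟨K, hK, rfl⟩ := exists_eq_C_of_leadingCoeff_pos hc gc
    obtain ⟨E, hE, rfl⟩ := exists_eq_C_of_leadingCoeff_pos hepos ge
    refine Or.inl ⟨A, B, E, hA, hB, hE, ⟨d, ?_⟩, ⟨K, ?_⟩⟩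
    · rw [← habd]
      simp
    · apply C_injective
      simpa [mul_comm] using he
  · obtain ⟨B, hB, rfl⟩ := exists_eq_C_of_leadingCoeff_pos hb gb
    obtain ⟨K, hK, rfl⟩ := exists_eq_C_of_leadingCoeff_pos hc gc
    obtain ⟨F, hF, rfl⟩ := exists_eq_C_of_leadingCoeff_pos hfpos gf
    refine Or.inr (Or.inl ⟨B, K, F, hB, hK, hF, ⟨d, ?_⟩, ⟨a, ?_⟩⟩)
    · rw [← hf']
      simp
    · linear_combination -haf
  · obtain ⟨B, hB, rfl⟩ := exists_eq_C_of_leadingCoeff_pos hb gb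
    obtain ⟨D, hD, rfl⟩ := exists_eq_C_of_leadingCoeff_pos hd gd
    obtain ⟨E, hE, rfl⟩ := exists_eq_C_of_leadingCoeff_pos hepos ge
    obtain ⟨F, hF, rfl⟩ := exists_eq_C_of_leadingCoeff_pos hfpos gf
    refine Or.inr (Or.inr (Or.inl ⟨B, D, F, hB, hD, hF, ⟨c, ?_⟩, ⟨E, ?_⟩⟩))
    · rw [← hf']
      simp only [C_mul, map_ofNat]
      ring
    · apply C_injective
      simp only [C_mul, C_add, C_pow, map_ofNat, C_1]
      linear_combination -hef
  · obtain ⟨K, hK, rfl⟩ := exists_eq_C_of_leadingCoeff_pos hc gc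
    obtain ⟨D, hD, rfl⟩ := exists_eq_C_of_leadingCoeff_pos hd gd
    obtain ⟨F, hF, rfl⟩ := exists_eq_C_of_leadingCoeff_pos hfpos gf
    have hdiv : C (4 * K * D) ∣ p + C F := by
      refine ⟨b, ?_⟩
      rw [← hf']
      simp only [C_mul, map_ofNat]
      ring
    refine Or.inr (Or.inr (Or.inr ⟨K, D, F, hK, hD, hF, ?_, hdiv, ⟨4 * a * C K * C D - p, ?_⟩⟩))
    · have hg : C ((Int.gcd (4 * K * D) F : ℕ) : ℤ) ∣ p :=
        (dvd_add_left (map_dvd C (Int.gcd_dvd_right _ _))).mp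
          ((map_dvd C (Int.gcd_dvd_left _ _)).trans hdiv)
      have hu := (hp.isPrimitive (by lia)) _ hg
      simpa using Int.isUnit_iff_natAbs_eq.mp hu
    · rw [hff]
      simp
  · obtain ⟨K, hK, rfl⟩ := exists_eq_C_of_leadingCoeff_pos hc gc
    obtain ⟨D, hD, rfl⟩ := exists_eq_C_of_leadingCoeff_pos hd gd
    refine absurd ⟨4 * a * C K * C D - p, ?_⟩
      (not_dvd_sq_add_const (q := p) (k := 4 * K ^ 2 * D) (by positivity) gf)
    rw [hff]
    simp

theorem conditions_of_dvd_two_of_natDegree_le (hpdeg : p.natDegree = 1)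
    (hplead : 0 < p.leadingCoeff) {a b c d : ℤ[X]}
    (ha : 0 < a.leadingCoeff) (hb : 0 < b.leadingCoeff) (hc : 0 < c.leadingCoeff)
    (hd : 0 < d.leadingCoeff) (hdvd : c ∣ a + b) (h : 4 * a * b * c * d = p * c + (a + b))
    (hba : b.natDegree ≤ a.natDegree) :
    (∃ B K D : ℤ, 0 < B ∧ 0 < K ∧ 0 < D ∧ C (4 * B * K * D - 1) ∣ (C B + C K * p)) ∨
    (∃ A B E : ℤ, 0 < A ∧ 0 < B ∧ 0 < E ∧ C (4 * A * B) ∣ (p + C E) ∧ E ∣ (A + B)) ∨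
    (∃ B D E : ℤ, 0 < B ∧ 0 < D ∧ 0 < E ∧
      C (4 * B * D * E) ∣ (p + C E + C (4 * B ^ 2 * D))) := by
  obtain ⟨e, he⟩ := hdvd
  have hab := leadingCoeff_add_pos_s11 ha hb
  have hepos : 0 < e.leadingCoeff := leadingCoeff_pos_of_mul hab hc he.symm
  have hc0 := ne_zero_of_leadingCoeff_pos hc
  have hpc := leadingCoeff_mul_pos hplead hc
  have habd : 4 * a * b * d = p + e := by
    apply mul_left_cancel₀ hc0
    linear_combination h + he
  have d1 := congrArg natDegree he
  have d3 := congrArg natDegree h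
  have d4 := congrArg natDegree habd
  have h4a := leadingCoeff_mul_pos leadingCoeff_four_pos ha
  have h4ab := leadingCoeff_mul_pos h4a hb
  have h4abc := leadingCoeff_mul_pos h4ab hc
  rw [natDegree_add_of_leadingCoeff_pos_s11 ha hb, natDegree_mul_of_leadingCoeff_pos hc hepos] at d1
  rw [natDegree_add_of_leadingCoeff_pos_s11 hpc hab, natDegree_mul_of_leadingCoeff_pos hplead hc,
    natDegree_add_of_leadingCoeff_pos_s11 ha hb,
    natDegree_mul_of_leadingCoeff_pos h4abc hd, natDegree_mul_of_leadingCoeff_pos h4ab hc,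
    natDegree_mul_of_leadingCoeff_pos h4a hb,
    natDegree_mul_of_leadingCoeff_pos leadingCoeff_four_pos ha, natDegree_four] at d3
  obtain ⟨f, hf⟩ : ∃ f, f = 4 * b * c * d - 1 := ⟨_, rfl⟩
  have haf : a * f = p * c + b := by rw [hf]; linear_combination h
  have hfpos : 0 < f.leadingCoeff := leadingCoeff_pos_of_mul (leadingCoeff_add_pos_s11 hpc hb) ha haf
  have d2 := congrArg natDegree haf
  have d5 := congrArg natDegree (show 4 * b * c * d = f + 1 by rw [hf]; ring)
  have h4b := leadingCoeff_mul_pos leadingCoeff_four_pos hb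
  have h4bc := leadingCoeff_mul_pos h4b hc
  rw [natDegree_add_of_leadingCoeff_pos_s11 hpc hb, natDegree_mul_of_leadingCoeff_pos hplead hc,
    natDegree_mul_of_leadingCoeff_pos ha hfpos] at d2
  rw [natDegree_add_of_leadingCoeff_pos_s11 hfpos (by simp),
    natDegree_mul_of_leadingCoeff_pos h4bc hd, natDegree_mul_of_leadingCoeff_pos h4b hc,
    natDegree_mul_of_leadingCoeff_pos leadingCoeff_four_pos hb, natDegree_four,
    natDegree_one] at d5
  have hcases : (b.natDegree = 0 ∧ c.natDegree = 0 ∧ d.natDegree = 0) ∨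
      (a.natDegree = 0 ∧ b.natDegree = 0 ∧ c.natDegree = 0 ∧ e.natDegree = 0) ∨
      (b.natDegree = 0 ∧ d.natDegree = 0 ∧ e.natDegree = 0) := by
    lia
  rcases hcases with ⟨gb, gc, gd⟩ | ⟨ga, gb, gc, ge⟩ | ⟨gb, gd, ge⟩
  · obtain ⟨B, hB, rfl⟩ := exists_eq_C_of_leadingCoeff_pos hb gb
    obtain ⟨K, hK, rfl⟩ := exists_eq_C_of_leadingCoeff_pos hc gc
    obtain ⟨D, hD, rfl⟩ := exists_eq_C_of_leadingCoeff_pos hd gd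
    refine Or.inl ⟨B, K, D, hB, hK, hD, ⟨a, ?_⟩⟩
    simp only [C_mul, C_sub, map_ofNat, C_1]
    linear_combination -h
  · obtain ⟨A, hA, rfl⟩ := exists_eq_C_of_leadingCoeff_pos ha ga
    obtain ⟨B, hB, rfl⟩ := exists_eq_C_of_leadingCoeff_pos hb gb
    obtain ⟨K, hK, rfl⟩ := exists_eq_C_of_leadingCoeff_pos hc gc
    obtain ⟨E, hE, rfl⟩ := exists_eq_C_of_leadingCoeff_pos hepos ge
    refine Or.inr (Or.inl ⟨A, B, E, hA, hB, hE, ⟨d, ?_⟩, ⟨K, ?_⟩⟩)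
    · rw [← habd]
      simp
    · apply C_injective
      simpa [mul_comm] using he
  · obtain ⟨B, hB, rfl⟩ := exists_eq_C_of_leadingCoeff_pos hb gb
    obtain ⟨D, hD, rfl⟩ := exists_eq_C_of_leadingCoeff_pos hd gd
    obtain ⟨E, hE, rfl⟩ := exists_eq_C_of_leadingCoeff_pos hepos ge
    refine Or.inr (Or.inr ⟨B, D, E, hB, hD, hE, ⟨c, ?_⟩⟩)
    simp only [C_mul, C_pow, map_ofNat]
    linear_combination 4 * C B * C D * he - habd

theorem conditions_of_dvd_one (hp : Irreducible p) (hpdeg : p.natDegree = 1)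
    (hplead : 0 < p.leadingCoeff) {X₁ X₂ X₃ : ℤ[X]} (h₁ : 0 < X₁.leadingCoeff)
    (h₂ : 0 < X₂.leadingCoeff) (h₃ : 0 < X₃.leadingCoeff)
    (h : 4 * X₁ * X₂ * X₃ = p * (X₂ * X₃ + X₃ * X₁ + X₁ * X₂))
    (hd₁ : p ∣ X₁) (hd₂ : ¬ p ∣ X₂) (hd₃ : ¬ p ∣ X₃) :
    (∃ A B E : ℤ, 0 < A ∧ 0 < B ∧ 0 < E ∧ C (4 * A * B) ∣ (C E * p + 1) ∧ E ∣ (A + B)) ∨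
    (∃ B K F : ℤ, 0 < B ∧ 0 < K ∧ 0 < F ∧ C (4 * B * K) ∣ (p + C F) ∧ C F ∣ (C B * p + C K)) ∨
    (∃ B D F : ℤ, 0 < B ∧ 0 < D ∧ 0 < F ∧ C (4 * B * D) ∣ (p + C F) ∧ F ∣ (4 * B ^ 2 * D + 1)) ∨
    (∃ K D F : ℤ, 0 < K ∧ 0 < D ∧ 0 < F ∧ Int.gcd (4 * K * D) F = 1 ∧
      C (4 * K * D) ∣ (p + C F) ∧ C F ∣ (p ^ 2 + C (4 * K ^ 2 * D))) := by
  obtain ⟨x, rfl⟩ := hd₁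
  obtain ⟨a, b, c, d, ha, hb, hc, hd, hdvd, hk⟩ :=
    exists_factorization_of_unit_fraction_identity (r := 1) (s := p)
      (leadingCoeff_pos_of_mul h₁ hplead rfl) h₂ h₃ isRelPrime_one_left
      (hp.isRelPrime_iff_not_dvd.mpr hd₂) (hp.isRelPrime_iff_not_dvd.mpr hd₃)
      (mul_left_cancel₀ hp.ne_zero (by linear_combination h))
  rw [one_mul] at hk
  rcases le_total b.natDegree a.natDegree with hle | hle
  · exact conditions_of_dvd_one_of_natDegree_le hp hpdeg hplead ha hb hc hd hdvd hk hle
  · exact conditions_of_dvd_one_of_natDegree_le hp hpdeg hplead hb ha hc hd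
      (by rwa [add_comm]) (by linear_combination hk) hle

theorem conditions_of_dvd_two (hp : Irreducible p) (hpdeg : p.natDegree = 1)
    (hplead : 0 < p.leadingCoeff) {X₁ X₂ X₃ : ℤ[X]} (h₁ : 0 < X₁.leadingCoeff)
    (h₂ : 0 < X₂.leadingCoeff) (h₃ : 0 < X₃.leadingCoeff)
    (h : 4 * X₁ * X₂ * X₃ = p * (X₂ * X₃ + X₃ * X₁ + X₁ * X₂))
    (hd₁ : ¬ p ∣ X₁) (hd₂ : p ∣ X₂) (hd₃ : p ∣ X₃) :
    (∃ B K D : ℤ, 0 < B ∧ 0 < K ∧ 0 < D ∧ C (4 * B * K * D - 1) ∣ (C B + C K * p)) ∨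
    (∃ A B E : ℤ, 0 < A ∧ 0 < B ∧ 0 < E ∧ C (4 * A * B) ∣ (p + C E) ∧ E ∣ (A + B)) ∨
    (∃ B D E : ℤ, 0 < B ∧ 0 < D ∧ 0 < E ∧
      C (4 * B * D * E) ∣ (p + C E + C (4 * B ^ 2 * D))) := by
  obtain ⟨y, rfl⟩ := hd₂
  obtain ⟨z, rfl⟩ := hd₃
  obtain ⟨a, b, c, d, ha, hb, hc, hd, hdvd, hk⟩ :=
    exists_factorization_of_unit_fraction_identity (r := p) (s := 1) (x := X₁) (y := y) (z := z)
      h₁ (leadingCoeff_pos_of_mul h₂ hplead rfl) (leadingCoeff_pos_of_mul h₃ hplead rfl)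
      (hp.isRelPrime_iff_not_dvd.mpr hd₁) isRelPrime_one_left isRelPrime_one_left
      (mul_left_cancel₀ (pow_ne_zero 2 hp.ne_zero) (by linear_combination h))
  rw [one_mul] at hk
  rcases le_total b.natDegree a.natDegree with hle | hle
  · exact conditions_of_dvd_two_of_natDegree_le hpdeg hplead ha hb hc hd hdvd hk hle
  · exact conditions_of_dvd_two_of_natDegree_le hpdeg hplead hb ha hc hd
      (by rwa [add_comm]) (by linear_combination hk) hle

theorem not_dvd_all (hp : Irreducible p) (hplead : 0 < p.leadingCoeff) {X₁ X₂ X₃ : ℤ[X]}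
    (h₁ : 0 < X₁.leadingCoeff) (h₂ : 0 < X₂.leadingCoeff) (h₃ : 0 < X₃.leadingCoeff)
    (h : 4 * X₁ * X₂ * X₃ = p * (X₂ * X₃ + X₃ * X₁ + X₁ * X₂))
    (hd₁ : p ∣ X₁) (hd₂ : p ∣ X₂) : ¬ p ∣ X₃ := by
  rintro ⟨z, rfl⟩
  obtain ⟨x, rfl⟩ := hd₁
  obtain ⟨y, rfl⟩ := hd₂
  refine unit_fraction_sum_ne_four (leadingCoeff_pos_of_mul h₁ hplead rfl)
    (leadingCoeff_pos_of_mul h₂ hplead rfl) (leadingCoeff_pos_of_mul h₃ hplead rfl) ?_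
  exact mul_left_cancel₀ (pow_ne_zero 3 hp.ne_zero) (by linear_combination h)

theorem dvd_some (hp : Irreducible p) (hpdeg : p.natDegree = 1) {X₁ X₂ X₃ : ℤ[X]}
    (h : 4 * X₁ * X₂ * X₃ = p * (X₂ * X₃ + X₃ * X₁ + X₁ * X₂)) :
    p ∣ X₁ ∨ p ∣ X₂ ∨ p ∣ X₃ := by
  have hprime := hp.prime
  rcases hprime.dvd_or_dvd (Dvd.intro _ h.symm) with h' | h'
  · rcases hprime.dvd_or_dvd h' with h' | h'
    · rcases hprime.dvd_or_dvd h' with h' | h'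
      · have := natDegree_le_of_dvd h' (ne_zero_of_leadingCoeff_pos leadingCoeff_four_pos)
        rw [natDegree_four] at this
        lia
      · exact Or.inl h'
    · exact Or.inr (Or.inl h')
  · exact Or.inr (Or.inr h')

end Necessity

section Sufficiency

variable {p : ℤ[X]}

theorem IsEgyptian3Poly.of_dvd_one (hplead : 0 < p.leadingCoeff) {a b c d : ℤ[X]}
    (ha : 0 < a.leadingCoeff) (hb : 0 < b.leadingCoeff) (hc : 0 < c.leadingCoeff)
    (hd : 0 < d.leadingCoeff) (h : 4 * a * b * c * d = c + p * (a + b)) :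
    IsEgyptian3Poly p := by
  refine ⟨a * b * d * p, a * c * d, b * c * d,
    leadingCoeff_mul_pos (leadingCoeff_mul_pos (leadingCoeff_mul_pos ha hb) hd) hplead,
    leadingCoeff_mul_pos (leadingCoeff_mul_pos ha hc) hd,
    leadingCoeff_mul_pos (leadingCoeff_mul_pos hb hc) hd, ?_⟩
  linear_combination a * b * c * d ^ 2 * p * h

theorem IsEgyptian3Poly.of_dvd_two (hplead : 0 < p.leadingCoeff) {a b c d : ℤ[X]}
    (ha : 0 < a.leadingCoeff) (hb : 0 < b.leadingCoeff) (hc : 0 < c.leadingCoeff)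
    (hd : 0 < d.leadingCoeff) (h : 4 * a * b * c * d = p * c + (a + b)) :
    IsEgyptian3Poly p := by
  refine ⟨a * b * d, a * c * d * p, b * c * d * p,
    leadingCoeff_mul_pos (leadingCoeff_mul_pos ha hb) hd,
    leadingCoeff_mul_pos (leadingCoeff_mul_pos (leadingCoeff_mul_pos ha hc) hd) hplead,
    leadingCoeff_mul_pos (leadingCoeff_mul_pos (leadingCoeff_mul_pos hb hc) hd) hplead, ?_⟩
  linear_combination a * b * c * d ^ 2 * p ^ 2 * h

theorem exists_pos_quotient {k : ℤ} (hk : 0 < k) {q : ℤ[X]} (hq : 0 < q.leadingCoeff)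
    (h : C k ∣ q) : ∃ r : ℤ[X], 0 < r.leadingCoeff ∧ q = C k * r := by
  obtain ⟨r, hr⟩ := h
  exact ⟨r, leadingCoeff_pos_of_mul hq (leadingCoeff_C_pos hk) hr.symm, hr⟩

end Sufficiency

theorem stmt_11 (p : Polynomial ℤ)
    (hp : Irreducible p) (hpdeg : p.natDegree = 1) (hplead : 0 < p.leadingCoeff) :
    IsEgyptian3Poly p ↔
      ((∃ B C D : ℤ, 0 < B ∧ 0 < C ∧ 0 < D ∧
          Polynomial.C (4 * B * C * D - 1) ∣ (Polynomial.C B + Polynomial.C C * p)) ∨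
       (∃ A B E : ℤ, 0 < A ∧ 0 < B ∧ 0 < E ∧
          Polynomial.C (4 * A * B) ∣ (p + Polynomial.C E) ∧ E ∣ (A + B)) ∨
       (∃ B D E : ℤ, 0 < B ∧ 0 < D ∧ 0 < E ∧
          Polynomial.C (4 * B * D * E) ∣ (p + Polynomial.C E + Polynomial.C (4 * B ^ 2 * D))) ∨
       (∃ A B E : ℤ, 0 < A ∧ 0 < B ∧ 0 < E ∧
          Polynomial.C (4 * A * B) ∣ (Polynomial.C E * p + 1) ∧ E ∣ (A + B)) ∨
       (∃ B C F : ℤ, 0 < B ∧ 0 < C ∧ 0 < F ∧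
          Polynomial.C (4 * B * C) ∣ (p + Polynomial.C F) ∧
          Polynomial.C F ∣ (Polynomial.C B * p + Polynomial.C C)) ∨
       (∃ B D F : ℤ, 0 < B ∧ 0 < D ∧ 0 < F ∧
          Polynomial.C (4 * B * D) ∣ (p + Polynomial.C F) ∧ F ∣ (4 * B ^ 2 * D + 1)) ∨
       (∃ C D F : ℤ, 0 < C ∧ 0 < D ∧ 0 < F ∧ Int.gcd (4 * C * D) F = 1 ∧
          Polynomial.C (4 * C * D) ∣ (p + Polynomial.C F) ∧
          Polynomial.C F ∣ (p ^ 2 + Polynomial.C (4 * C ^ 2 * D)))) := by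
  constructor
  · rintro ⟨X₁, X₂, X₃, h₁, h₂, h₃, h⟩
    have h' : 4 * X₂ * X₃ * X₁ = p * (X₃ * X₁ + X₁ * X₂ + X₂ * X₃) := by linear_combination h
    have h'' : 4 * X₃ * X₁ * X₂ = p * (X₁ * X₂ + X₂ * X₃ + X₃ * X₁) := by linear_combination h
    have hsome := dvd_some hp hpdeg h
    have hall := not_dvd_all hp hplead h₁ h₂ h₃ h
    by_cases hd₁ : p ∣ X₁ <;> by_cases hd₂ : p ∣ X₂ <;> by_cases hd₃ : p ∣ X₃
    · exact absurd hd₃ (hall hd₁ hd₂)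
    · exact (conditions_of_dvd_two hp hpdeg hplead h₃ h₁ h₂ h'' hd₃ hd₁ hd₂).imp_right
        (Or.imp_right Or.inl)
    · exact (conditions_of_dvd_two hp hpdeg hplead h₂ h₃ h₁ h' hd₂ hd₃ hd₁).imp_right
        (Or.imp_right Or.inl)
    · exact Or.inr (Or.inr (Or.inr
        (conditions_of_dvd_one hp hpdeg hplead h₁ h₂ h₃ h hd₁ hd₂ hd₃)))
    · exact (conditions_of_dvd_two hp hpdeg hplead h₁ h₂ h₃ h hd₁ hd₂ hd₃).imp_right
        (Or.imp_right Or.inl)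
    · exact Or.inr (Or.inr (Or.inr
        (conditions_of_dvd_one hp hpdeg hplead h₂ h₃ h₁ h' hd₂ hd₃ hd₁)))
    · exact Or.inr (Or.inr (Or.inr
        (conditions_of_dvd_one hp hpdeg hplead h₃ h₁ h₂ h'' hd₃ hd₁ hd₂)))
    · exact absurd hsome (by simp [hd₁, hd₂, hd₃])
  · rintro (⟨B, K, D, hB, hK, hD, h⟩ | ⟨A, B, E, hA, hB, hE, h, K, hAB⟩ |
      ⟨B, D, E, hB, hD, hE, h⟩ | ⟨A, B, E, hA, hB, hE, h, K, hAB⟩ | ⟨B, K, F, hB, hK, hF, h, h'⟩ |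
      ⟨B, D, F, hB, hD, hF, h, E, hE⟩ | ⟨K, D, F, hK, hD, hF, hgcd, h, h'⟩)
    · have hBKD : 0 < B * K * D := by positivity
      obtain ⟨a, ha, hk⟩ := exists_pos_quotient (by linarith)
        (leadingCoeff_add_pos_s11 (leadingCoeff_C_pos hB)
          (leadingCoeff_mul_pos (leadingCoeff_C_pos hK) hplead)) h
      refine .of_dvd_two hplead ha (leadingCoeff_C_pos hB) (leadingCoeff_C_pos hK)
        (leadingCoeff_C_pos hD) ?_
      simp only [C_mul, C_sub, map_ofNat, C_1] at hk
      linear_combination -hk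
    · have hK : 0 < K := pos_of_mul_pos_right (hAB ▸ add_pos hA hB) hE.le
      obtain ⟨d, hd, hk⟩ := exists_pos_quotient (by positivity)
        (leadingCoeff_add_pos_s11 hplead (leadingCoeff_C_pos hE)) h
      refine .of_dvd_two hplead (leadingCoeff_C_pos hA) (leadingCoeff_C_pos hB)
        (leadingCoeff_C_pos hK) hd ?_
      have hAB' := congrArg C hAB
      simp only [C_mul, C_add, map_ofNat] at hk hAB'
      linear_combination -C K * hk - hAB'
    · obtain ⟨c, hc, hk⟩ := exists_pos_quotient (by positivity)
        (leadingCoeff_add_pos_s11 (leadingCoeff_add_pos_s11 hplead (leadingCoeff_C_pos hE))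
          (leadingCoeff_C_pos (k := 4 * B ^ 2 * D) (by positivity))) h
      simp only [C_mul, C_pow, map_ofNat] at hk
      have ha : 0 < (c * C E - C B).leadingCoeff := by
        refine leadingCoeff_pos_of_mul (q := C (4 * B * D))
          (leadingCoeff_add_pos_s11 hplead (leadingCoeff_C_pos hE))
          (leadingCoeff_C_pos (by positivity)) ?_
        simp only [C_mul, map_ofNat]
        linear_combination -hk
      refine .of_dvd_two hplead ha (leadingCoeff_C_pos hB) hc (leadingCoeff_C_pos hD) ?_
      linear_combination -c * hk
    · have hK : 0 < K := pos_of_mul_pos_right (hAB ▸ add_pos hA hB) hE.le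
      obtain ⟨d, hd, hk⟩ := exists_pos_quotient (by positivity)
        (leadingCoeff_add_pos_s11 (leadingCoeff_mul_pos (leadingCoeff_C_pos hE) hplead) (by simp)) h
      refine .of_dvd_one hplead (leadingCoeff_C_pos hA) (leadingCoeff_C_pos hB)
        (leadingCoeff_C_pos hK) hd ?_
      have hAB' := congrArg C hAB
      simp only [C_mul, C_add, map_ofNat] at hk hAB'
      linear_combination -C K * hk - p * hAB'
    · obtain ⟨d, hd, hk⟩ := exists_pos_quotient (by positivity)
        (leadingCoeff_add_pos_s11 hplead (leadingCoeff_C_pos hF)) h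
      obtain ⟨a, ha, hk'⟩ := exists_pos_quotient hF
        (leadingCoeff_add_pos_s11 (leadingCoeff_mul_pos (leadingCoeff_C_pos hB) hplead)
          (leadingCoeff_C_pos hK)) h'
      refine .of_dvd_one hplead ha (leadingCoeff_C_pos hB) (leadingCoeff_C_pos hK) hd ?_
      simp only [C_mul, map_ofNat] at hk
      linear_combination -a * hk - hk'
    · obtain ⟨c, hc, hk⟩ := exists_pos_quotient (by positivity)
        (leadingCoeff_add_pos_s11 hplead (leadingCoeff_C_pos hF)) h
      have hE' := congrArg C hE
      simp only [C_mul, C_add, C_pow, map_ofNat, C_1] at hk hE'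
      have hFa : C F * (c * C E - C B) = c + C B * p := by
        linear_combination -c * hE' - C B * hk
      have ha : 0 < (c * C E - C B).leadingCoeff :=
        leadingCoeff_pos_of_mul (leadingCoeff_add_pos_s11 hc
          (leadingCoeff_mul_pos (leadingCoeff_C_pos hB) hplead)) (leadingCoeff_C_pos hF) hFa
      refine .of_dvd_one hplead ha (leadingCoeff_C_pos hB) hc (leadingCoeff_C_pos hD) ?_
      linear_combination -(c * C E - C B) * hk + hFa
    · obtain ⟨b, hb, hk⟩ := exists_pos_quotient (by positivity)
        (leadingCoeff_add_pos_s11 hplead (leadingCoeff_C_pos hF)) h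
      obtain ⟨g, hg⟩ := h'
      have hcop : IsCoprime (C F) (C (4 * K * D)) :=
        ((Int.isCoprime_iff_gcd_eq_one.mpr hgcd).symm).map C
      simp only [C_mul, C_pow, map_ofNat] at hk hg hcop
      have hdvd : C F ∣ p * b + C K := by
        refine hcop.dvd_of_dvd_mul_left ⟨g + p, ?_⟩
        linear_combination hg - p * hk
      obtain ⟨a, ha, hk'⟩ := exists_pos_quotient hF
        (leadingCoeff_add_pos_s11 (leadingCoeff_mul_pos hplead hb) (leadingCoeff_C_pos hK)) hdvd
      refine .of_dvd_one hplead ha hb (leadingCoeff_C_pos hK) (leadingCoeff_C_pos hD) ?_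
      linear_combination -a * hk - hk'
end

section
/- Let p be an odd prime number. Then 4/p is 3-Egyptian if and only if there exist positive integers satisfying at least one of the following seven modular conditions: (1a) ∃ B C D, (4BCD − 1) ∣ (B + pC); (1b) ∃ A B E, 4AB ∣ (p + E) and E ∣ (A + B); (1c) ∃ B D E, 4BDE ∣ (p + E + 4B²D); (2a) ∃ A B E, 4AB ∣ (pE + 1) and E ∣ (A + B); (2b) ∃ B C F, 4BC ∣ (p + F) and F ∣ (pB + C); (2c) ∃ B D F, 4BD ∣ (p + F) and F ∣ (4B²D + 1); (2d) ∃ C D F with gcd(4CD, F) = 1, 4CD ∣ (p + F) and F ∣ (p² + 4C²D). -/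
theorem isEgyptian3_iff_nat {n : ℕ} (hn : 0 < n) :
    IsEgyptian3 n ↔ ∃ x y z : ℕ, 0 < x ∧ 0 < y ∧ 0 < z ∧
      4 * x * y * z = n * (x * y + y * z + z * x) := by
  unfold IsEgyptian3
  refine exists_congr fun x ↦ exists_congr fun y ↦ exists_congr fun z ↦ ?_
  refine and_congr_right fun hx ↦ and_congr_right fun hy ↦ and_congr_right fun hz ↦ ?_
  rw [← Nat.cast_inj (R := ℚ)]
  push_cast
  field_simp
  constructor <;> intro h <;> linear_combination h

/-- Parametrized solutions in which one denominator carries the factor `n`. -/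
theorem IsEgyptian3.of_one_multiple {n a b c d : ℕ} (hn : 0 < n) (ha : 0 < a) (hb : 0 < b)
    (hc : 0 < c) (hd : 0 < d) (h : 4 * a * b * c * d = n * (a + b) + c) : IsEgyptian3 n := by
  rw [isEgyptian3_iff_nat hn]
  refine ⟨n * a * b * d, a * c * d, b * c * d, by positivity, by positivity, by positivity, ?_⟩
  linear_combination (n * a * b * c * d ^ 2) * h

/-- Parametrized solutions in which two denominators carry the factor `n`. -/
theorem IsEgyptian3.of_two_multiples {n a b c d : ℕ} (hn : 0 < n) (ha : 0 < a) (hb : 0 < b)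
    (hc : 0 < c) (hd : 0 < d) (h : 4 * a * b * c * d = a + b + n * c) : IsEgyptian3 n := by
  rw [isEgyptian3_iff_nat hn]
  refine ⟨a * b * d, n * a * c * d, n * b * c * d, by positivity, by positivity, by positivity, ?_⟩
  linear_combination (n ^ 2 * a * b * c * d ^ 2) * h

theorem IsEgyptian3.of_dvd_mul_add {n b c f : ℕ} (hn : 0 < n) (hb : 0 < b) (hc : 0 < c)
    (h₁ : 4 * b * c ∣ n + f) (h₂ : f ∣ n * b + c) : IsEgyptian3 n := by
  obtain ⟨d, hd⟩ := h₁
  obtain ⟨a, ha⟩ := h₂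
  have hd0 : 0 < d := Nat.pos_of_ne_zero (by rintro rfl; omega)
  have ha0 : 0 < a := Nat.pos_of_ne_zero (by rintro rfl; omega)
  refine .of_one_multiple hn ha0 hb hc hd0 ?_
  zify at *
  linear_combination -a * hd - ha

theorem exists_of_two_multiples {p x y z : ℕ} (hp : p.Prime) (hx : 0 < x) (hy : 0 < y)
    (hz : 0 < z) (hpx : ¬ p ∣ x) (h : 4 * x * y * z = x * (y + z) + p * y * z) :
    ∃ a b c d : ℕ, 0 < a ∧ 0 < b ∧ 0 < c ∧ 0 < d ∧ 4 * a * b * c * d = a + b + p * c := by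
  obtain ⟨a, b, hab, hya, hzb⟩ := Nat.exists_coprime y z
  set g := Nat.gcd y z
  have hg : 0 < g := Nat.gcd_pos_of_pos_left z hy
  have ha : 0 < a := Nat.pos_of_ne_zero (by rintro rfl; omega)
  have hb : 0 < b := Nat.pos_of_ne_zero (by rintro rfl; omega)
  have h1 : 4 * x * g * (a * b) = x * (a + b) + p * g * (a * b) := by
    apply Nat.eq_of_mul_eq_mul_left hg
    rw [hya, hzb] at h
    linear_combination h
  have hcop : Nat.Coprime (a * b) (a + b) := by
    apply Nat.Coprime.mul_left <;> simpa [Nat.coprime_comm] using hab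
  have h2 : a * b ∣ x * (a + b) :=
    (Nat.dvd_add_left (Dvd.intro_left (p * g) rfl)).1 (h1 ▸ Dvd.intro_left (4 * x * g) rfl)
  obtain ⟨d, rfl⟩ := hcop.dvd_of_dvd_mul_right h2
  have hd : 0 < d := Nat.pos_of_mul_pos_left hx
  have h3 : d * (4 * a * b * g) = d * (a + b) + p * g := by
    apply Nat.eq_of_mul_eq_mul_left (Nat.mul_pos ha hb)
    linear_combination h1
  have h4 : d ∣ p * g :=
    (Nat.dvd_add_right (Dvd.intro _ rfl)).1 (h3 ▸ Dvd.intro _ rfl)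
  have hpd : Nat.Coprime d p :=
    ((Nat.Prime.coprime_iff_not_dvd hp).2 fun hd ↦ hpx (hd.mul_left _)).symm
  obtain ⟨c, hc⟩ := hpd.dvd_of_dvd_mul_left h4
  have hc0 : 0 < c := Nat.pos_of_ne_zero (by rintro rfl; omega)
  refine ⟨a, b, c, d, ha, hb, hc0, hd, ?_⟩
  apply Nat.eq_of_mul_eq_mul_left hd
  rw [hc] at h3
  linear_combination h3

theorem exists_of_one_multiple {p x y z : ℕ} (hp : p.Prime) (hx : 0 < x) (hy : 0 < y)
    (hz : 0 < z) (hpy : ¬ p ∣ y) (hpz : ¬ p ∣ z)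
    (h : 4 * x * y * z = p * x * (y + z) + y * z) :
    ∃ a b d e : ℕ, 0 < a ∧ 0 < b ∧ 0 < e ∧ 4 * a * b * d = p * e + 1 ∧ e ∣ a + b := by
  obtain ⟨a, b, hab, hya, hzb⟩ := Nat.exists_coprime y z
  set g := Nat.gcd y z
  have hg : 0 < g := Nat.gcd_pos_of_pos_left z hy
  have ha : 0 < a := Nat.pos_of_ne_zero (by rintro rfl; omega)
  have hb : 0 < b := Nat.pos_of_ne_zero (by rintro rfl; omega)
  have h1 : 4 * x * g * (a * b) = p * x * (a + b) + g * (a * b) := by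
    apply Nat.eq_of_mul_eq_mul_left hg
    rw [hya, hzb] at h
    linear_combination h
  have hcop : Nat.Coprime (a * b) (a + b) := by
    apply Nat.Coprime.mul_left <;> simpa [Nat.coprime_comm] using hab
  have hpab : Nat.Coprime (a * b) p := by
    refine ((Nat.Prime.coprime_iff_not_dvd hp).2 fun hd ↦ ?_).symm
    rcases hp.dvd_mul.1 hd with hd | hd
    · exact hpy (hya ▸ hd.mul_right _)
    · exact hpz (hzb ▸ hd.mul_right _)
  have h2 : a * b ∣ p * x * (a + b) :=
    (Nat.dvd_add_left (Dvd.intro_left g rfl)).1 (h1 ▸ Dvd.intro_left (4 * x * g) rfl)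
  obtain ⟨d, rfl⟩ := hpab.dvd_of_dvd_mul_left (hcop.dvd_of_dvd_mul_right h2)
  have hd : 0 < d := Nat.pos_of_mul_pos_left hx
  have h3 : d * (4 * a * b * g) = d * (p * (a + b)) + g := by
    apply Nat.eq_of_mul_eq_mul_left (Nat.mul_pos ha hb)
    linear_combination h1
  obtain ⟨c, hc⟩ : d ∣ g := (Nat.dvd_add_right (Dvd.intro _ rfl)).1 (h3 ▸ Dvd.intro _ rfl)
  have hc0 : 0 < c := Nat.pos_of_ne_zero (by rintro rfl; omega)
  have h4 : c * (4 * a * b * d) = p * (a + b) + c := by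
    apply Nat.eq_of_mul_eq_mul_left hd
    rw [hc] at h3
    linear_combination h3
  have h5 : c ∣ p * (a + b) :=
    (Nat.dvd_add_left (dvd_refl c)).1 (h4 ▸ Dvd.intro _ rfl)
  have hpc : Nat.Coprime c p := by
    refine ((Nat.Prime.coprime_iff_not_dvd hp).2 fun hd' ↦ hpy ?_).symm
    rw [hya, hc]
    exact (hd'.mul_left _).mul_left _
  obtain ⟨e, he⟩ := hpc.dvd_of_dvd_mul_left h5
  have he0 : 0 < e := Nat.pos_of_ne_zero (by rintro rfl; omega)
  refine ⟨a, b, d, e, ha, hb, he0, ?_, Dvd.intro_left c he.symm⟩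
  apply Nat.eq_of_mul_eq_mul_left hc0
  rw [he] at h4
  linear_combination h4

theorem four_mul_ne_of_pos {x y z : ℕ} (hx : 0 < x) (hy : 0 < y) (hz : 0 < z) :
    4 * x * y * z ≠ x * y + y * z + z * x := by
  have h1 : x * y ≤ x * y * z := Nat.le_mul_of_pos_right _ hz
  have h2 : y * z ≤ x * y * z := by
    rw [mul_assoc]; exact Nat.le_mul_of_pos_left _ hx
  have h3 : z * x ≤ x * y * z := by
    rw [mul_right_comm, mul_comm z x]; exact Nat.le_mul_of_pos_right _ hy
  have h4 : 0 < x * y * z := by positivity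
  have h5 : 4 * x * y * z = 4 * (x * y * z) := by ring
  omega

/-- Up to reordering, a solution of `4 / p = 1 / x + 1 / y + 1 / z` has exactly one or exactly two
denominators divisible by `p`. -/
theorem exists_parameters_of_isEgyptian3 {p : ℕ} (hp : p.Prime) (hodd : Odd p)
    (h : IsEgyptian3 p) :
    (∃ a b c d : ℕ, 0 < a ∧ 0 < b ∧ 0 < c ∧ 0 < d ∧ 4 * a * b * c * d = a + b + p * c) ∨
    ∃ a b d e : ℕ, 0 < a ∧ 0 < b ∧ 0 < e ∧ 4 * a * b * d = p * e + 1 ∧ e ∣ a + b := by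
  have hp0 := hp.pos
  obtain ⟨x, y, z, hx, hy, hz, h⟩ := (isEgyptian3_iff_nat hp0).1 h
  have hdvd : p ∣ x ∨ p ∣ y ∨ p ∣ z := by
    have h4 : ¬ p ∣ 4 := fun h4 ↦ by
      have : p = 2 := (Nat.prime_dvd_prime_iff_eq hp Nat.prime_two).1
        (hp.dvd_of_dvd_pow (show p ∣ 2 ^ 2 from h4))
      subst this
      exact absurd hodd (by decide)
    have : p ∣ 4 * x * y * z := h ▸ Dvd.intro _ rfl
    simp only [hp.dvd_mul] at this
    tauto
  wlog hpx : p ∣ x generalizing x y z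
  · rcases hdvd with hd | hd | hd
    · exact absurd hd hpx
    · exact this y z x hy hz hx (by linear_combination h) (.inl hd) hd
    · exact this z x y hz hx hy (by linear_combination h) (.inl hd) hd
  clear hdvd
  obtain ⟨x, rfl⟩ := hpx
  have hx := Nat.pos_of_mul_pos_left hx
  have h : 4 * x * y * z = p * x * (y + z) + y * z := by
    apply Nat.eq_of_mul_eq_mul_left hp0
    linear_combination h
  by_cases hpyz : p ∣ y ∨ p ∣ z
  · left
    wlog hpy : p ∣ y generalizing y z
    · exact this z y hz hy (by linear_combination ‹4 * (p * x) * y * z = _›)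
        (by linear_combination h) hpyz.symm (by tauto)
    obtain ⟨y, rfl⟩ := hpy
    have hy := Nat.pos_of_mul_pos_left hy
    have h : 4 * z * x * y = z * (x + y) + p * x * y := by
      apply Nat.eq_of_mul_eq_mul_left hp0
      linear_combination h
    refine exists_of_two_multiples hp hz hx hy ?_ h
    rintro ⟨z, rfl⟩
    refine four_mul_ne_of_pos hx hy (Nat.pos_of_mul_pos_left hz) ?_
    apply Nat.eq_of_mul_eq_mul_left hp0
    linear_combination h
  · right
    push Not at hpyz
    exact exists_of_one_multiple hp hx hy hz hpyz.1 hpyz.2 h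

theorem stmt_12 (p : ℕ) (hp : p.Prime) (hodd : Odd p) :
    IsEgyptian3 p ↔
      ((∃ B C D : ℕ, 0 < B ∧ 0 < C ∧ 0 < D ∧
          (4 * B * C * D - 1) ∣ (B + p * C)) ∨
       (∃ A B E : ℕ, 0 < A ∧ 0 < B ∧ 0 < E ∧
          4 * A * B ∣ (p + E) ∧ E ∣ (A + B)) ∨
       (∃ B D E : ℕ, 0 < B ∧ 0 < D ∧ 0 < E ∧
          4 * B * D * E ∣ (p + E + 4 * B ^ 2 * D)) ∨
       (∃ A B E : ℕ, 0 < A ∧ 0 < B ∧ 0 < E ∧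
          4 * A * B ∣ (p * E + 1) ∧ E ∣ (A + B)) ∨
       (∃ B C F : ℕ, 0 < B ∧ 0 < C ∧ 0 < F ∧
          4 * B * C ∣ (p + F) ∧ F ∣ (p * B + C)) ∨
       (∃ B D F : ℕ, 0 < B ∧ 0 < D ∧ 0 < F ∧
          4 * B * D ∣ (p + F) ∧ F ∣ (4 * B ^ 2 * D + 1)) ∨
       (∃ C D F : ℕ, 0 < C ∧ 0 < D ∧ 0 < F ∧ Nat.gcd (4 * C * D) F = 1 ∧
          4 * C * D ∣ (p + F) ∧ F ∣ (p ^ 2 + 4 * C ^ 2 * D))) := by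
  have hp0 := hp.pos
  constructor
  · intro h
    obtain ⟨a, b, c, d, ha, hb, hc, hd, h⟩ | ⟨a, b, d, e, ha, hb, he, h, hdvd⟩ :=
      exists_parameters_of_isEgyptian3 hp hodd h
    · refine .inl ⟨b, c, d, hb, hc, hd, a, ?_⟩
      have : 1 ≤ 4 * b * c * d := Nat.one_le_iff_ne_zero.2 (by positivity)
      zify [this] at *
      linear_combination -h
    · exact .inr <| .inr <| .inr <| .inl ⟨a, b, e, ha, hb, he, ⟨d, h.symm⟩, hdvd⟩
  · rintro (⟨b, c, d, hb, hc, hd, a, h⟩ | ⟨a, b, e, ha, hb, he, ⟨d, hd⟩, ⟨c, hc⟩⟩ |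
      ⟨b, d, e, hb, hd, he, ⟨c, h⟩⟩ | ⟨a, b, e, ha, hb, he, ⟨d, hd⟩, ⟨c, hc⟩⟩ |
      ⟨b, c, f, hb, hc, hf, h₁, h₂⟩ | ⟨b, d, f, hb, hd, hf, ⟨c, hc⟩, ⟨e, he⟩⟩ |
      ⟨c, d, f, hc, hd, hf, hgcd, ⟨b, hb⟩, h₂⟩)
    · have ha : 0 < a := Nat.pos_of_ne_zero (by rintro rfl; omega)
      refine .of_two_multiples hp0 ha hb hc hd ?_
      have : 1 ≤ 4 * b * c * d := Nat.one_le_iff_ne_zero.2 (by positivity)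
      zify [this] at *
      linear_combination -h
    · have hd0 : 0 < d := Nat.pos_of_ne_zero (by rintro rfl; omega)
      have hc0 : 0 < c := Nat.pos_of_ne_zero (by rintro rfl; omega)
      refine .of_two_multiples hp0 ha hb hc0 hd0 ?_
      zify at *
      linear_combination -c * hd - hc
    · have hc0 : 0 < c := Nat.pos_of_ne_zero (by rintro rfl; omega)
      have hlt : b < c * e := by
        by_contra! hle
        have := Nat.mul_le_mul_left (4 * b * d) hle
        nlinarith
      obtain ⟨a, ha⟩ := Nat.exists_eq_add_of_lt hlt
      refine .of_two_multiples (a := a + 1) hp0 a.succ_pos hb hc0 hd ?_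
      zify at *
      linear_combination (1 - 4 * b * c * d : ℤ) * ha - c * h
    · have hd0 : 0 < d := Nat.pos_of_ne_zero (by rintro rfl; omega)
      have hc0 : 0 < c := Nat.pos_of_ne_zero (by rintro rfl; omega)
      refine .of_one_multiple hp0 ha hb hc0 hd0 ?_
      zify at *
      linear_combination -c * hd - p * hc
    · exact .of_dvd_mul_add hp0 hb hc h₁ h₂
    · have hc0 : 0 < c := Nat.pos_of_ne_zero (by rintro rfl; omega)
      refine .of_dvd_mul_add hp0 hb hc0 (f := f) ⟨d, by linear_combination hc⟩ ?_
      have hcop : Nat.Coprime f (4 * b * d) := by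
        have h1 : Nat.Coprime (4 * b ^ 2 * d + 1) (4 * b * d) := by
          rw [show 4 * b ^ 2 * d + 1 = 1 + b * (4 * b * d) by ring]
          simp
        exact h1.coprime_dvd_left ⟨e, he⟩
      refine hcop.dvd_of_dvd_mul_left ⟨p * e + 1, ?_⟩
      linear_combination p * he - hc
    · have hb0 : 0 < b := Nat.pos_of_ne_zero (by rintro rfl; omega)
      refine .of_dvd_mul_add hp0 hb0 hc (f := f) ⟨d, by linear_combination hb⟩ ?_
      refine (Nat.Coprime.symm hgcd).dvd_of_dvd_mul_left ?_
      rw [show 4 * c * d * (p * b + c) = p ^ 2 + 4 * c ^ 2 * d + f * p by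
        linear_combination p * hb.symm]
      exact dvd_add h₂ (Dvd.intro _ rfl)
end

section
/- Let n be a positive integer. If there exist positive integers B, C, D such that (4BCD − 1) divides (B + nC), then 4/n is 3-Egyptian. -/
theorem stmt_13 (n : ℕ) (hn : 0 < n)
    (h : ∃ B C D : ℕ, 0 < B ∧ 0 < C ∧ 0 < D ∧ (4 * B * C * D - 1) ∣ (B + n * C)) :
    IsEgyptian3 n := by
  obtain ⟨B, C, D, hB, hC, hD, A, hA⟩ := h
  have hA0 : 0 < A := by
    rcases Nat.eq_zero_or_pos A with rfl | hpos
    · simp only [mul_zero] at hA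
      omega
    · exact hpos
  have hpos : 0 < 4 * B * C * D := by positivity
  have key : (B + n * C + A : ℚ) = 4 * B * C * D * A := by
    have hQ : (B + n * C : ℚ) = ((4 * B * C * D - 1 : ℕ) : ℚ) * A := by exact_mod_cast hA
    rw [Nat.cast_sub hpos] at hQ
    push_cast at hQ
    linear_combination hQ
  refine ⟨n * B * C * D, n * A * C * D, A * B * D, by positivity, by positivity,
    by positivity, ?_⟩
  push_cast
  field_simp
  linear_combination -key
end

section
/- Let n be a positive integer. If there exist positive integers A, B, E such that 4AB divides (n + E) and E divides (A + B), then 4/n is 3-Egyptian. -/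
theorem stmt_14 (n : ℕ) (hn : 0 < n)
    (h : ∃ A B E : ℕ, 0 < A ∧ 0 < B ∧ 0 < E ∧ 4 * A * B ∣ (n + E) ∧ E ∣ (A + B)) :
    IsEgyptian3 n := by
  obtain ⟨A, B, E, hA, hB, hE, ⟨k, hk⟩, ⟨m, hm⟩⟩ := h
  have hk0 : 0 < k := by
    rcases Nat.eq_zero_or_pos k with rfl | hpos
    · simp at hk; omega
    · exact hpos
  have hm0 : 0 < m := by
    rcases Nat.eq_zero_or_pos m with rfl | hpos
    · simp at hm; omega
    · exact hpos
  refine ⟨A * B * k, m * n * B * k, m * n * A * k, by positivity, by positivity,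
    by positivity, ?_⟩
  have hkQ : (n : ℚ) + E = 4 * A * B * k := by exact_mod_cast hk
  have hmQ : (A : ℚ) + B = E * m := by exact_mod_cast hm
  push_cast
  field_simp
  linear_combination (-(m : ℚ)) * hkQ - hmQ
end

section
/- Let n be a positive integer. If there exist positive integers B, D, E such that 4BDE divides (n + E + 4B²D), then 4/n is 3-Egyptian. -/
theorem stmt_15 (n : ℕ) (hn : 0 < n)
    (h : ∃ B D E : ℕ, 0 < B ∧ 0 < D ∧ 0 < E ∧ 4 * B * D * E ∣ (n + E + 4 * B ^ 2 * D)) :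
    IsEgyptian3 n := by
  obtain ⟨B, D, E, hB, hD, hE, k, hk⟩ := h
  have hlt : B < E * k := by
    by_contra! hle
    have := Nat.mul_le_mul_left (4 * B * D) hle
    nlinarith
  obtain ⟨m, hm⟩ := Nat.exists_eq_add_of_lt hlt
  have hk0 : 0 < k := Nat.pos_of_ne_zero (by rintro rfl; simp at hlt)
  refine ⟨B * D * (m + 1), k * n * B * D, k * n * D * (m + 1),
    by positivity, by positivity, by positivity, ?_⟩
  have hkQ : (n : ℚ) + E + 4 * B ^ 2 * D = 4 * B * D * E * k := by exact_mod_cast hk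
  have hmQ : (E : ℚ) * k = B + m + 1 := by exact_mod_cast hm
  have hnE : (n : ℚ) + E = 4 * B * D * (m + 1) := by
    linear_combination hkQ + 4 * B * D * hmQ
  push_cast
  field_simp
  linear_combination (-(k : ℚ)) * hnE + hmQ
end

section
/- Let n be a positive integer. If there exist positive integers A, B, E such that 4AB divides (nE + 1) and E divides (A + B), then 4/n is 3-Egyptian. -/
theorem stmt_16 (n : ℕ) (hn : 0 < n)
    (h : ∃ A B E : ℕ, 0 < A ∧ 0 < B ∧ 0 < E ∧ 4 * A * B ∣ (n * E + 1) ∧ E ∣ (A + B)) :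
    IsEgyptian3 n := by
  obtain ⟨A, B, E, hA, hB, hE, ⟨k, hk⟩, ⟨m, hm⟩⟩ := h
  have hk0 : 0 < k := Nat.pos_of_ne_zero (by rintro rfl; simp at hk)
  have hm0 : 0 < m := Nat.pos_of_ne_zero (by rintro rfl; simp at hm; omega)
  refine ⟨m * A * k, m * B * k, n * A * B * k, by positivity, by positivity, by positivity, ?_⟩
  have hkq : (n * E + 1 : ℚ) = 4 * A * B * k := by exact_mod_cast hk
  have hmq : (A + B : ℚ) = E * m := by exact_mod_cast hm
  have hn' : (n : ℚ) ≠ 0 := by positivity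
  have hA' : (A : ℚ) ≠ 0 := by positivity
  have hB' : (B : ℚ) ≠ 0 := by positivity
  have hk' : (k : ℚ) ≠ 0 := by positivity
  have hm' : (m : ℚ) ≠ 0 := by positivity
  push_cast
  field_simp
  linear_combination (-m : ℚ) * hkq - n * hmq
end

section
/- Let n be a positive integer. If there exist positive integers B, C, F such that 4BC divides (n + F) and F divides (nB + C), then 4/n is 3-Egyptian. -/
theorem stmt_17 (n : ℕ) (hn : 0 < n)
    (h : ∃ B C F : ℕ, 0 < B ∧ 0 < C ∧ 0 < F ∧ 4 * B * C ∣ (n + F) ∧ F ∣ (n * B + C)) :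
    IsEgyptian3 n := by
  obtain ⟨B, C, F, hB, hC, hF, ⟨k, hk⟩, ⟨m, hm⟩⟩ := h
  have hk0 : 0 < k := by
    rcases Nat.eq_zero_or_pos k with rfl | hk0
    · omega
    · exact hk0
  have hm0 : 0 < m := by
    rcases Nat.eq_zero_or_pos m with rfl | hm0
    · omega
    · exact hm0
  refine ⟨B * C * k, C * k * m, n * B * k * m, by positivity, by positivity, by positivity, ?_⟩
  have hkQ : (n : ℚ) + F = 4 * B * C * k := by exact_mod_cast hk
  have hmQ : (n : ℚ) * B + C = F * m := by exact_mod_cast hm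
  have hn' : (n : ℚ) ≠ 0 := by positivity
  have hB' : (B : ℚ) ≠ 0 := by positivity
  have hC' : (C : ℚ) ≠ 0 := by positivity
  have hk' : (k : ℚ) ≠ 0 := by positivity
  have hm' : (m : ℚ) ≠ 0 := by positivity
  push_cast
  calc (4 : ℚ) / n = (4 * B * C * k) / (n * B * C * k) := by field_simp
    _ = 1 / (B * C * k) + (F * m) / (n * B * C * k * m) := by rw [← hkQ]; field_simp
    _ = 1 / (B * C * k) + 1 / (C * k * m) + 1 / (n * B * k * m) := by
      rw [← hmQ]; field_simp; ring
end

section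
/- Let n be a positive integer. If there exist positive integers B, D, F such that 4BD divides (n + F) and F divides (4B²D + 1), then 4/n is 3-Egyptian. -/
theorem stmt_18 (n : ℕ) (hn : 0 < n)
    (h : ∃ B D F : ℕ, 0 < B ∧ 0 < D ∧ 0 < F ∧ 4 * B * D ∣ (n + F) ∧ F ∣ (4 * B ^ 2 * D + 1)) :
    IsEgyptian3 n := by
  obtain ⟨B, D, F, hB, hD, hF, ⟨k, hk⟩, ⟨e, he⟩⟩ := h
  have hk0 : 0 < k := by
    rcases Nat.eq_zero_or_pos k with rfl | h
    · omega
    · exact h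
  have hdvd : F ∣ n * B + k := by
    have h1 : F ∣ n * B + k + F * B := ⟨k * e, by linear_combination B * hk + k * he⟩
    exact (Nat.dvd_add_left (dvd_mul_right F B)).mp h1
  obtain ⟨m, hm⟩ := hdvd
  have hm0 : 0 < m := by
    rcases Nat.eq_zero_or_pos m with rfl | h
    · omega
    · exact h
  refine ⟨B * D * k, m * D * k, m * n * B * D, by positivity, by positivity, by positivity, ?_⟩
  have hkQ : (n : ℚ) + F = 4 * B * D * k := by exact_mod_cast hk
  have hmQ : (n : ℚ) * B + k = F * m := by exact_mod_cast hm
  push_cast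
  field_simp
  linear_combination -(m : ℚ) * hkQ - hmQ
end

section
/- Let n be a positive integer. If there exist positive integers C, D, F with gcd(4CD, F) = 1 such that 4CD divides (n + F) and F divides (n² + 4C²D), then 4/n is 3-Egyptian. -/
theorem isEgyptian3_of_mul_eq {n a b c d : ℕ} (hn : 0 < n) (ha : 0 < a) (hb : 0 < b)
    (hc : 0 < c) (hd : 0 < d) (h : 4 * a * b * c * d = n * a + n * b + c) :
    IsEgyptian3 n := by
  refine ⟨a * b * d * n, a * c * d, b * c * d, by positivity, by positivity, by positivity, ?_⟩
  have h' : (4 * a * b * c * d : ℚ) = n * a + n * b + c := mod_cast h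
  push_cast
  field_simp
  linear_combination h'

theorem stmt_19 (n : ℕ) (hn : 0 < n)
    (h : ∃ C D F : ℕ, 0 < C ∧ 0 < D ∧ 0 < F ∧ Nat.gcd (4 * C * D) F = 1 ∧ 4 * C * D ∣ (n + F) ∧ F ∣ (n ^ 2 + 4 * C ^ 2 * D)) :
    IsEgyptian3 n := by
  obtain ⟨C, D, F, hC, hD, hF, hcop, ⟨a, ha⟩, ⟨G, hG⟩⟩ := h
  have hdvd : 4 * C * D ∣ n + G := by
    refine Nat.Coprime.dvd_of_dvd_mul_left hcop ⟨n * a + C, ?_⟩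
    zify at ha hG ⊢
    linear_combination n * ha - hG
  obtain ⟨b, hb⟩ := hdvd
  have ha0 : 0 < a := Nat.pos_of_ne_zero (by rintro rfl; omega)
  have hb0 : 0 < b := Nat.pos_of_ne_zero (by rintro rfl; omega)
  refine isEgyptian3_of_mul_eq hn ha0 hb0 hC hD ?_
  apply Nat.eq_of_mul_eq_mul_left (show 0 < 4 * C * D by positivity)
  zify at ha hb hG ⊢
  linear_combination (n - 4 * C * D * b : ℤ) * ha - F * hb - hG
end
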